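/- For every iterated sequence S for Gr(3,6), the nonzero Plücker relations form a Gröbner basis of the Plücker ideal with respect to the weighting matrix M_S: In_{M_S}(𝓘_{3,6}) equals the ideal generated by { In_{M_S}(R_{I,J}) : I ∈ I_{2,6}, J ∈ I_{4,6}, R_{I,J} ≠ 0 }. -/

import Mathlib

/-!
Common framework: iterated sequences for Gr(3,n), the matrix `A_S`, pullbacks of
Plücker coordinates, the weighted reverse lexicographic order, lowest-term
valuations, Plücker relations, weighting matrices and initial ideals.
-/

open MvPolynomial

noncomputable section

/-- Height of a positive root `(i,j) ↦ j - i`. -/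
def Ht (β : ℕ × ℕ) : ℕ := β.2 - β.1

/-- `IsIter n S` : `S` is an iterated sequence for `Gr(3,n)`: it starts (as base of the
iteration) from a PBW sequence for `Gr(3,4)`, i.e. an ordering of `((1,4),(2,4),(3,4))`,
and for each `r = 5, …, n` a triple `((i₁,r),(i₂,r),(i₃,r))` with `i₁,i₂,i₃ ∈ [r-1]`
pairwise distinct is prepended. -/
inductive IsIter : ℕ → List (ℕ × ℕ) → Prop
  | base (L : List (ℕ × ℕ)) : L.Perm [(1,4),(2,4),(3,4)] → IsIter 4 L
  | step (r : ℕ) (L : List (ℕ × ℕ)) (i₁ i₂ i₃ : ℕ) :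
      4 ≤ r → IsIter r L →
      1 ≤ i₁ → i₁ ≤ r → 1 ≤ i₂ → i₂ ≤ r → 1 ≤ i₃ → i₃ ≤ r →
      i₁ ≠ i₂ → i₁ ≠ i₃ → i₂ ≠ i₃ →
      IsIter (r+1) ((i₁, r+1) :: (i₂, r+1) :: (i₃, r+1) :: L)

/-- `Sorted k n I` : `I ∈ I_{k,n}`, a strictly increasing `k`-tuple in `{1,…,n}`. -/
def Sorted (k n : ℕ) (I : Fin k → ℕ) : Prop :=
  StrictMono I ∧ ∀ a, 1 ≤ I a ∧ I a ≤ n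

/-- `ℕ`-indexed square "matrices" (1-based indexing, size given by a parameter `n`). -/
abbrev NMat := ℕ → ℕ → MvPolynomial (ℕ × ℕ) ℂ

/-- Product of two `n × n` matrices, 1-based indexing. -/
def matMul (n : ℕ) (A B : NMat) : NMat := fun i j => ∑ k ∈ Finset.Icc 1 n, A i k * B k j

/-- Identity matrix. -/
def idN : NMat := fun i j => if i = j then 1 else 0

/-- The factor `1 + x_β f_β`, where `f_β` is the matrix unit in entry `β = (i,j)`. -/
def factor (β : ℕ × ℕ) : NMat := fun i j =>
  (if i = j then (1 : MvPolynomial (ℕ × ℕ) ℂ) else 0) +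
    (if i = β.1 ∧ j = β.2 then (MvPolynomial.X β : MvPolynomial (ℕ × ℕ) ℂ) else 0)

/-- `A_S := (1 + x_{β_N} f_{β_N}) ⋯ (1 + x_{β_1} f_{β_1})` for `S = (β_1, …, β_N)`. -/
def ASmat (n : ℕ) : List (ℕ × ℕ) → NMat
  | [] => idN
  | β :: L => matMul n (ASmat n L) (factor β)

/-- `φ_S^*(p̄_I)` : the determinant of the `3×3` submatrix of `A_S` on rows `(1,2,3)`
and columns `I = (i₁,i₂,i₃)`. -/
def phiStar (n : ℕ) (S : List (ℕ × ℕ)) (I : Fin 3 → ℕ) : MvPolynomial (ℕ × ℕ) ℂ :=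
  Matrix.det (Matrix.of fun a b : Fin 3 => ASmat n S (a.val + 1) (I b))

/-- `Ψ_S(a) = Σ_l a_l Ht(β_l)`, the height-weighted function (written on exponents). -/
def Psi (d : (ℕ × ℕ) →₀ ℕ) : ℕ := d.sum fun β c => c * Ht β

/-- `a <_lex b` : lexicographic comparison of exponent vectors, the coordinates being
read in the order `β_1, …, β_N` of the sequence `S`. -/
def lexLT (S : List (ℕ × ℕ)) (a b : (ℕ × ℕ) →₀ ℕ) : Prop :=
  ∃ k < S.length, (∀ m < k, a (S.getD m (0,0)) = b (S.getD m (0,0))) ∧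
    a (S.getD k (0,0)) < b (S.getD k (0,0))

/-- `a ≤_lex b` on coordinates indexed by `S`. -/
def lexLE (S : List (ℕ × ℕ)) (a b : (ℕ × ℕ) →₀ ℕ) : Prop :=
  lexLT S a b ∨ ∀ k < S.length, a (S.getD k (0,0)) = b (S.getD k (0,0))

/-- `a ≺_{Ψ_S} b` : the strict `Ψ_S`-weighted reverse lexicographic order:
`Ψ_S(a) < Ψ_S(b)`, or `Ψ_S(a) = Ψ_S(b)` and `a >_lex b`. -/
def psiLT (S : List (ℕ × ℕ)) (a b : (ℕ × ℕ) →₀ ℕ) : Prop :=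
  Psi a < Psi b ∨ (Psi a = Psi b ∧ lexLT S b a)

/-- `a ⪯_{Ψ_S} b`. -/
def psiLE (S : List (ℕ × ℕ)) (a b : (ℕ × ℕ) →₀ ℕ) : Prop :=
  Psi a < Psi b ∨ (Psi a = Psi b ∧ lexLE S b a)

open scoped Classical in
/-- The `⪯_{Ψ_S}`-minimum of the support of a polynomial (defaulting to `0` if no
minimum exists). -/
def minSupp (S : List (ℕ × ℕ)) (f : MvPolynomial (ℕ × ℕ) ℂ) : (ℕ × ℕ) →₀ ℕ :=
  if h : ∃ m ∈ f.support, ∀ m' ∈ f.support, psiLE S m m' then h.choose else 0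

/-- The lowest-term valuation `v_S(p̄_I)` : the `⪯_{Ψ_S}`-minimum of the support of
`φ_S^*(p̄_I)`. -/
def valS (n : ℕ) (S : List (ℕ × ℕ)) (I : Fin 3 → ℕ) : (ℕ × ℕ) →₀ ℕ :=
  minSupp S (phiStar n S I)

/-- The index set `I_{3,n}` of Plücker variables. -/
abbrev MI (n : ℕ) := {v : Fin 3 → ℕ // Sorted 3 n v}

/-- The Plücker polynomial ring `ℂ[p_K : K ∈ I_{3,n}]`. -/
abbrev PRing (n : ℕ) := MvPolynomial (MI n) ℂ

open scoped Classical in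
/-- The Plücker variable `p_K`, defined to be `0` if `K` is not strictly increasing
(in particular `p_{I ∪ j} = 0` if `j ∈ I`). -/
def pvar (n : ℕ) (K : Fin 3 → ℕ) : PRing n :=
  if h : Sorted 3 n K then MvPolynomial.X (⟨K, h⟩ : MI n) else 0

/-- `I ∪ j` : the sorted triple obtained by adjoining `j` to the pair `I`. -/
def insert3 (I : Fin 2 → ℕ) (j : ℕ) : Fin 3 → ℕ :=
  fun a => (List.insertionSort (· ≤ ·) [I 0, I 1, j]).getD a 0

/-- `J ∖ j` : the sorted triple obtained by removing `j` from the 4-tuple `J`. -/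
def erase4 (J : Fin 4 → ℕ) (j : ℕ) : Fin 3 → ℕ :=
  fun a => (([J 0, J 1, J 2, J 3]).erase j).getD a 0

/-- The Plücker relation
`R_{I,J} = Σ_{j ∈ J} (−1)^{#{i∈I : i<j} + #{j'∈J : j<j'}} p_{I∪j} p_{J∖j}`. -/
def Rrel (n : ℕ) (I : Fin 2 → ℕ) (J : Fin 4 → ℕ) : PRing n :=
  ∑ a : Fin 4,
    (-1 : PRing n) ^ ((Finset.univ.filter fun b : Fin 2 => I b < J a).card +
        (Finset.univ.filter fun b : Fin 4 => J a < J b).card) *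
      (pvar n (insert3 I (J a)) * pvar n (erase4 J (J a)))

/-- The Plücker ideal `𝓘_{3,n}`, generated by all Plücker relations. -/
def PluckerIdeal (n : ℕ) : Ideal (PRing n) :=
  Ideal.span {f | ∃ I J, Sorted 2 n I ∧ Sorted 4 n J ∧ f = Rrel n I J}

/-- `M_S · m = Σ_K m_K v_S(p̄_K)` : the weighting matrix applied to an exponent. -/
def MSdot (n : ℕ) (S : List (ℕ × ℕ)) (m : MI n →₀ ℕ) : (ℕ × ℕ) →₀ ℕ :=
  m.sum fun K c => c • valS n S K.val

open scoped Classical in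
/-- The initial form `In_{M_S}(f)` : the sum of the terms of `f` whose `M_S`-weight is
`⪯_{Ψ_S}`-minimal. -/
def inM (n : ℕ) (S : List (ℕ × ℕ)) (f : PRing n) : PRing n :=
  ∑ m ∈ f.support.filter fun m => ∀ m' ∈ f.support, psiLE S (MSdot n S m) (MSdot n S m'),
    MvPolynomial.monomial m (f.coeff m)

/-- The initial ideal `In_{M_S}(𝓘_{3,n}) = ⟨In_{M_S}(g) : g ∈ 𝓘_{3,n}, g ≠ 0⟩`. -/
def InIdeal (n : ℕ) (S : List (ℕ × ℕ)) : Ideal (PRing n) :=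
  Ideal.span {g | ∃ f, f ∈ PluckerIdeal n ∧ f ≠ 0 ∧ g = inM n S f}

/-- Evaluation of the `ℤ`-linear functional with coefficients `c` on an exponent
vector (i.e. an element `e ∈ (ℤ^{3(n-3)})^*` given by its coefficients). -/
def evalF (c : ℕ × ℕ → ℤ) (d : (ℕ × ℕ) →₀ ℕ) : ℤ := d.sum fun β m => c β * (m : ℤ)

/-- `v_S(p̄_{I∪j}) + v_S(p̄_{J∖j})`, the `M_S`-weight of the term of `R_{I,J}`
corresponding to `j = J a`. -/
def wvec (n : ℕ) (S : List (ℕ × ℕ)) (I : Fin 2 → ℕ) (J : Fin 4 → ℕ) (a : Fin 4) :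
    (ℕ × ℕ) →₀ ℕ :=
  valS n S (insert3 I (J a)) + valS n S (erase4 J (J a))

/-- A `ℤ`-linear functional `e` (given by its coefficients `c`) *preserves inequalities*
with respect to `S` if for every nonzero Plücker relation `R_{I,J}` and all
`s₁, s₂ ∈ J ∖ I`, `v_S(p̄_{I∪s₁}) + v_S(p̄_{J∖s₁}) ≺_{Ψ_S} v_S(p̄_{I∪s₂}) + v_S(p̄_{J∖s₂})`
implies the corresponding strict inequality of the values of `e`. -/
def PreservesIneq (n : ℕ) (S : List (ℕ × ℕ)) (c : ℕ × ℕ → ℤ) : Prop :=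
  ∀ (I : Fin 2 → ℕ) (J : Fin 4 → ℕ), Sorted 2 n I → Sorted 4 n J → Rrel n I J ≠ 0 →
    ∀ a b : Fin 4, (∀ t : Fin 2, I t ≠ J a) → (∀ t : Fin 2, I t ≠ J b) →
      psiLT S (wvec n S I J a) (wvec n S I J b) →
      evalF c (wvec n S I J a) < evalF c (wvec n S I J b)

end

theorem Psi_add (a b : (ℕ × ℕ) →₀ ℕ) : Psi (a + b) = Psi a + Psi b := by
  unfold Psi
  exact Finsupp.sum_add_index' (by simp) (by intros; ring)

theorem Psi_single (β : ℕ × ℕ) (c : ℕ) : Psi (Finsupp.single β c) = c * Ht β := by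
  simp [Psi]

section Order

variable {S : List (ℕ × ℕ)} {a b c e : (ℕ × ℕ) →₀ ℕ}

theorem lexLT_not_lexLE (h : lexLT S a b) : ¬ lexLE S b a := by
  obtain ⟨k, hk, h1, h2⟩ := h
  rintro (⟨k', hk', h1', h2'⟩ | h')
  · rcases lt_trichotomy k k' with hlt | rfl | hlt
    · have := h1' k hlt; omega
    · omega
    · have := h1 k' hlt; omega
  · have := h' k hk; omega

theorem psiLT_not_psiLE (h : psiLT S a b) : ¬ psiLE S b a := by
  rcases h with h | ⟨h, h'⟩
  · rintro (h2 | ⟨h2, -⟩) <;> omega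
  · rintro (h2 | ⟨-, h2⟩)
    · omega
    · exact lexLT_not_lexLE h' h2

theorem psiLE_refl (S : List (ℕ × ℕ)) (a : (ℕ × ℕ) →₀ ℕ) : psiLE S a a :=
  Or.inr ⟨rfl, Or.inr fun _ _ => rfl⟩

theorem psiLT.le (h : psiLT S a b) : psiLE S a b := by
  rcases h with h | ⟨h, h'⟩
  · exact Or.inl h
  · exact Or.inr ⟨h, Or.inl h'⟩

theorem psiLT_irrefl (S : List (ℕ × ℕ)) (a : (ℕ × ℕ) →₀ ℕ) : ¬ psiLT S a a :=
  fun h => psiLT_not_psiLE h (psiLE_refl S a)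

theorem lexLT_add_right (h : lexLT S a b) (c : (ℕ × ℕ) →₀ ℕ) : lexLT S (a + c) (b + c) := by
  obtain ⟨k, hk, h1, h2⟩ := h
  refine ⟨k, hk, fun m hm => ?_, ?_⟩
  · simp only [Finsupp.add_apply, h1 m hm]
  · simpa using h2

theorem lexLT_add (h : lexLT S a b) (h' : lexLT S c e) : lexLT S (a + c) (b + e) := by
  obtain ⟨k, hk, h1, h2⟩ := h
  obtain ⟨k', hk', h1', h2'⟩ := h'
  refine ⟨min k k', by omega, fun m hm => ?_, ?_⟩
  · simp only [Finsupp.add_apply, h1 m (by omega), h1' m (by omega)]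
  · simp only [Finsupp.add_apply]
    rcases lt_trichotomy k k' with hlt | rfl | hlt
    · rw [min_eq_left hlt.le]
      have := h1' k hlt
      omega
    · rw [min_self]; omega
    · rw [min_eq_right hlt.le]
      have := h1 k' hlt
      omega

theorem psiLT_add_right (h : psiLT S a b) (c : (ℕ × ℕ) →₀ ℕ) : psiLT S (a + c) (b + c) := by
  rcases h with h | ⟨h, h'⟩
  · left; simp only [Psi_add]; omega
  · right; exact ⟨by simp only [Psi_add]; omega, lexLT_add_right h' c⟩

theorem psiLT_add (h : psiLT S a b) (h' : psiLT S c e) : psiLT S (a + c) (b + e) := by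
  rcases h with h | ⟨h, hl⟩ <;> rcases h' with h' | ⟨h', hl'⟩
  · left; simp only [Psi_add]; omega
  · left; simp only [Psi_add]; omega
  · left; simp only [Psi_add]; omega
  · right; exact ⟨by simp only [Psi_add]; omega, lexLT_add hl hl'⟩

end Order

/-- `f` has `⪯_{Ψ_S}`-lowest monomial `v`, with nonzero coefficient `c`, and every other
monomial of `f` is strictly larger. -/
def IsLead (S : List (ℕ × ℕ)) (f : MvPolynomial (ℕ × ℕ) ℂ) (v : (ℕ × ℕ) →₀ ℕ) (c : ℂ) : Prop :=
  c ≠ 0 ∧ coeff v f = c ∧ ∀ m ∈ f.support, m ≠ v → psiLT S v m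

namespace IsLead

variable {S : List (ℕ × ℕ)} {f g : MvPolynomial (ℕ × ℕ) ℂ} {v w : (ℕ × ℕ) →₀ ℕ} {c e : ℂ}

theorem neg (h : IsLead S f v c) : IsLead S (-f) v (-c) := by
  obtain ⟨h0, h1, h2⟩ := h
  exact ⟨neg_ne_zero.2 h0, by simp [h1], fun m hm => h2 m (by simpa using hm)⟩

theorem monomial (S : List (ℕ × ℕ)) (v : (ℕ × ℕ) →₀ ℕ) (hc : c ≠ 0) :
    IsLead S (MvPolynomial.monomial v c) v c := by
  refine ⟨hc, by simp, fun m hm hne => ?_⟩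
  rw [mem_support_iff, coeff_monomial] at hm
  exact absurd (by simpa using hm : v = m ∧ _).1.symm hne

theorem add (h : IsLead S f v c) (hg : ∀ m ∈ g.support, psiLT S v m) :
    IsLead S (f + g) v c := by
  classical
  obtain ⟨h0, h1, h2⟩ := h
  have hv : coeff v g = 0 := by
    by_contra hne
    exact psiLT_irrefl S v (hg v (mem_support_iff.2 hne))
  refine ⟨h0, by simp [h1, hv], fun m hm hne => ?_⟩
  rcases Finset.mem_union.1 (support_add hm) with hm | hm
  · exact h2 m hm hne
  · exact hg m hm

theorem mul (h : IsLead S f v c) (h' : IsLead S g w e) : IsLead S (f * g) (v + w) (c * e) := by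
  classical
  obtain ⟨h0, h1, h2⟩ := h
  obtain ⟨h0', h1', h2'⟩ := h'
  have key : ∀ a ∈ f.support, ∀ b ∈ g.support, (a, b) ≠ (v, w) → psiLT S (v + w) (a + b) := by
    intro a ha b hb hab
    by_cases hav : a = v
    · subst hav
      have hbw : b ≠ w := fun h => hab (by rw [h])
      simpa [add_comm] using psiLT_add_right (h2' b hb hbw) a
    · by_cases hbw : b = w
      · subst hbw
        exact psiLT_add_right (h2 a ha hav) b
      · exact psiLT_add (h2 a ha hav) (h2' b hb hbw)
  refine ⟨mul_ne_zero h0 h0', ?_, fun m hm hne => ?_⟩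
  · rw [coeff_mul, Finset.sum_eq_single (v, w)]
    · simp [h1, h1']
    · rintro ⟨a, b⟩ hab hne
      by_contra hc
      have hab' := Finset.HasAntidiagonal.mem_antidiagonal.1 hab
      simp only at hab' hc
      have := key a (mem_support_iff.2 (left_ne_zero_of_mul hc)) b
        (mem_support_iff.2 (right_ne_zero_of_mul hc)) hne
      rw [hab'] at this
      exact psiLT_irrefl S _ this
    · intro h; simp at h
  · obtain ⟨a, ha, b, hb, rfl⟩ := Finset.mem_add.1 (support_mul f g hm)
    exact key a ha b hb (fun h => hne (by simp_all))

theorem minSupp_eq (h : IsLead S f v c) : minSupp S f = v := by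
  obtain ⟨h0, h1, h2⟩ := h
  have hv : v ∈ f.support := mem_support_iff.2 (by rwa [h1])
  have hex : ∃ m ∈ f.support, ∀ m' ∈ f.support, psiLE S m m' := by
    refine ⟨v, hv, fun m hm => ?_⟩
    by_cases hmv : m = v
    · subst hmv; exact psiLE_refl S m
    · exact (h2 m hm hmv).le
  unfold minSupp
  rw [dif_pos hex]
  by_contra hne
  exact psiLT_not_psiLE (h2 _ hex.choose_spec.1 hne) (hex.choose_spec.2 v hv)

end IsLead

/-- `S` is the iterated sequence for `Gr(3,6)` whose blocks are
`((i 1,6),(i 2,6),(i 3,6))`, `((j 1,5),(j 2,5),(j 3,5))` and `L`; the values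
`i 0 = 6` and `j 0 = 5` are added for uniformity. -/
structure IterData (S : List (ℕ × ℕ)) (i j : ℕ → ℕ) (L : List (ℕ × ℕ)) : Prop where
  eq : S = (i 1, 6) :: (i 2, 6) :: (i 3, 6) :: (j 1, 5) :: (j 2, 5) :: (j 3, 5) :: L
  perm : L.Perm [(1, 4), (2, 4), (3, 4)]
  i_zero : i 0 = 6
  j_zero : j 0 = 5
  i_mem : ∀ k, 1 ≤ k → k ≤ 3 → 1 ≤ i k ∧ i k ≤ 5
  j_mem : ∀ k, 1 ≤ k → k ≤ 3 → 1 ≤ j k ∧ j k ≤ 4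
  i_inj : ∀ k l, k ≤ 3 → l ≤ 3 → i k = i l → k = l
  j_inj : ∀ k l, k ≤ 3 → l ≤ 3 → j k = j l → k = l

theorem IsIter.eq_base_or_step {n : ℕ} {S : List (ℕ × ℕ)} (h : IsIter n S) :
    (n = 4 ∧ S.Perm [(1, 4), (2, 4), (3, 4)]) ∨
    (4 < n ∧ ∃ L i₁ i₂ i₃, S = (i₁, n) :: (i₂, n) :: (i₃, n) :: L ∧ IsIter (n - 1) L ∧
      (1 ≤ i₁ ∧ i₁ < n) ∧ (1 ≤ i₂ ∧ i₂ < n) ∧ (1 ≤ i₃ ∧ i₃ < n) ∧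
      i₁ ≠ i₂ ∧ i₁ ≠ i₃ ∧ i₂ ≠ i₃) := by
  cases h with
  | base _ hL => exact Or.inl ⟨rfl, hL⟩
  | step r L i₁ i₂ i₃ hr hL h1 h1' h2 h2' h3 h3' h12 h13 h23 =>
    exact Or.inr ⟨by omega, L, i₁, i₂, i₃, rfl, hL, by omega, by omega, by omega, h12, h13, h23⟩

theorem IsIter.exists_iterData {S : List (ℕ × ℕ)} (h : IsIter 6 S) :
    ∃ i j L, IterData S i j L := by
  obtain ⟨h, -⟩ | ⟨-, L, i₁, i₂, i₃, rfl, hL, hi₁, hi₂, hi₃, h12, h13, h23⟩ := h.eq_base_or_step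
  · omega
  obtain ⟨h, -⟩ | ⟨-, L', j₁, j₂, j₃, rfl, hL', hj₁, hj₂, hj₃, h12', h13', h23'⟩ :=
    hL.eq_base_or_step
  · omega
  obtain ⟨-, hp⟩ | ⟨h, -⟩ := hL'.eq_base_or_step
  swap
  · omega
  refine ⟨fun k => ([6, i₁, i₂, i₃]).getD k 0, fun k => ([5, j₁, j₂, j₃]).getD k 0, L',
    rfl, hp, rfl, rfl, ?_, ?_, ?_, ?_⟩
  · intro k h1 h2
    interval_cases k <;> simp <;> omega
  · intro k h1 h2
    interval_cases k <;> simp <;> omega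
  · intro k l hk hl
    interval_cases k <;> interval_cases l <;> simp <;> omega
  · intro k l hk hl
    interval_cases k <;> interval_cases l <;> simp <;> omega

theorem ASmat_cons {β : ℕ × ℕ} {L : List (ℕ × ℕ)} {a b : ℕ}
    (h1 : β.1 ∈ Finset.Icc 1 6) (hb : b ∈ Finset.Icc 1 6) :
    ASmat 6 (β :: L) a b =
      ASmat 6 L a b + if b = β.2 then ASmat 6 L a β.1 * X β else 0 := by
  simp only [ASmat, matMul, factor, mul_add, Finset.sum_add_distrib]
  congr 1
  · rw [Finset.sum_eq_single b]
    · simp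
    · intro k _ hk; simp [hk]
    · intro h; exact absurd hb h
  · split_ifs with h
    · rw [Finset.sum_eq_single β.1]
      · simp [h]
      · intro k _ hk; simp [hk]
      · intro h; exact absurd h1 h
    · simp [h]

theorem ASmat_block {r t₁ t₂ t₃ : ℕ} (hr : r ≤ 6) (h₁ : 1 ≤ t₁) (h₁' : t₁ < r) (h₂ : 1 ≤ t₂)
    (h₂' : t₂ < r) (h₃ : 1 ≤ t₃) (h₃' : t₃ < r) {L : List (ℕ × ℕ)} {a b : ℕ}
    (hb : b ∈ Finset.Icc 1 6) :
    ASmat 6 ((t₁, r) :: (t₂, r) :: (t₃, r) :: L) a b = ASmat 6 L a b +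
      if b = r then ASmat 6 L a t₁ * X (t₁, r) + ASmat 6 L a t₂ * X (t₂, r) +
        ASmat 6 L a t₃ * X (t₃, r) else 0 := by
  have hm₁ : t₁ ∈ Finset.Icc 1 6 := by simp; omega
  have hm₂ : t₂ ∈ Finset.Icc 1 6 := by simp; omega
  have hm₃ : t₃ ∈ Finset.Icc 1 6 := by simp; omega
  rw [ASmat_cons hm₁ hb, ASmat_cons hm₂ hb, ASmat_cons hm₂ hm₁, ASmat_cons hm₃ hb,
    ASmat_cons hm₃ hm₁, ASmat_cons hm₃ hm₂]
  simp only [h₁'.ne, h₂'.ne, if_false, add_zero]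
  split_ifs
  · ring
  · simp

theorem ASmat_base {L : List (ℕ × ℕ)} (hL : ∀ β ∈ L, 1 ≤ β.1 ∧ β.1 ≤ 3 ∧ β.2 = 4)
    (hn : L.Nodup) {a b : ℕ} (hb : b ∈ Finset.Icc 1 6) :
    ASmat 6 L a b = (if a = b then 1 else 0) +
      if b = 4 ∧ (a, 4) ∈ L then X (a, 4) else 0 := by
  induction L generalizing b with
  | nil => simp [ASmat, idN]
  | cons β L ih =>
    have hβ := hL β (by simp)
    have hL' : ∀ γ ∈ L, 1 ≤ γ.1 ∧ γ.1 ≤ 3 ∧ γ.2 = 4 := fun γ hγ => hL γ (by simp [hγ])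
    have hn' := List.nodup_cons.1 hn
    have hβm : β.1 ∈ Finset.Icc 1 6 := by simp; omega
    obtain ⟨x, y⟩ := β
    obtain ⟨h1, h2, h3⟩ := hβ
    simp only at h1 h2 h3
    subst h3
    rw [ASmat_cons hβm hb, ih hL' hn'.2 hb, ih hL' hn'.2 hβm]
    have hx4 : x ≠ 4 := by omega
    by_cases hb4 : b = 4
    · subst hb4
      by_cases hax : a = x
      · subst hax
        simp [hn'.1, hx4]
      · simp [hax, hx4]
    · simp [hb4]

namespace IterData

variable {S : List (ℕ × ℕ)} {i j : ℕ → ℕ} {L : List (ℕ × ℕ)} (hS : IterData S i j L)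
include hS

theorem mem_base {β : ℕ × ℕ} : β ∈ L ↔ (1 ≤ β.1 ∧ β.1 ≤ 3 ∧ β.2 = 4) := by
  rw [hS.perm.mem_iff]
  obtain ⟨x, y⟩ := β
  simp
  omega

theorem base_entry {a b : ℕ} (hb : b ∈ Finset.Icc 1 6) :
    ASmat 6 L a b = (if a = b then 1 else 0) +
      if b = 4 ∧ (a, 4) ∈ L then X (a, 4) else 0 :=
  ASmat_base (fun _ h => hS.mem_base.1 h) (hS.perm.nodup_iff.2 (by decide)) hb

theorem entry_eq {a b : ℕ} (hb : b ∈ Finset.Icc 1 6) :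
    ASmat 6 S a b = ASmat 6 L a b +
      (if b = 5 then ASmat 6 L a (j 1) * X (j 1, 5) + ASmat 6 L a (j 2) * X (j 2, 5) +
        ASmat 6 L a (j 3) * X (j 3, 5) else 0) +
      (if b = 6 then ASmat 6 S a (i 1) * X (i 1, 6) + ASmat 6 S a (i 2) * X (i 2, 6) +
        ASmat 6 S a (i 3) * X (i 3, 6) else 0) := by
  have hi1 := hS.i_mem 1 (by omega) (by omega)
  have hi2 := hS.i_mem 2 (by omega) (by omega)
  have hi3 := hS.i_mem 3 (by omega) (by omega)
  have hj1 := hS.j_mem 1 (by omega) (by omega)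
  have hj2 := hS.j_mem 2 (by omega) (by omega)
  have hj3 := hS.j_mem 3 (by omega) (by omega)
  have h5 : ∀ x, ∀ b ∈ Finset.Icc 1 6,
      ASmat 6 ((j 1, 5) :: (j 2, 5) :: (j 3, 5) :: L) x b = ASmat 6 L x b +
        if b = 5 then ASmat 6 L x (j 1) * X (j 1, 5) + ASmat 6 L x (j 2) * X (j 2, 5) +
          ASmat 6 L x (j 3) * X (j 3, 5) else 0 :=
    fun x b hb => ASmat_block (by omega) hj1.1 (by omega) hj2.1 (by omega) hj3.1 (by omega) hb
  have h6 : ∀ x, ∀ b ∈ Finset.Icc 1 6, ASmat 6 S x b =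
      ASmat 6 ((j 1, 5) :: (j 2, 5) :: (j 3, 5) :: L) x b + if b = 6 then
        ASmat 6 ((j 1, 5) :: (j 2, 5) :: (j 3, 5) :: L) x (i 1) * X (i 1, 6) +
        ASmat 6 ((j 1, 5) :: (j 2, 5) :: (j 3, 5) :: L) x (i 2) * X (i 2, 6) +
        ASmat 6 ((j 1, 5) :: (j 2, 5) :: (j 3, 5) :: L) x (i 3) * X (i 3, 6) else 0 := by
    intro x b hb
    rw [hS.eq]
    exact ASmat_block (by omega) hi1.1 (by omega) hi2.1 (by omega) hi3.1 (by omega) hb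
  have h6' : ∀ k, 1 ≤ k → k ≤ 5 → ASmat 6 S a k =
      ASmat 6 ((j 1, 5) :: (j 2, 5) :: (j 3, 5) :: L) a k := by
    intro k hk hk'
    rw [h6 a k (by simp; omega), if_neg (by omega), add_zero]
  rw [h6 a b hb, h6' _ hi1.1 hi1.2, h6' _ hi2.1 hi2.2, h6' _ hi3.1 hi3.2, h5 a b hb]

theorem entry_le_three {a b : ℕ} (hb : 1 ≤ b) (hb' : b ≤ 3) :
    ASmat 6 S a b = if a = b then 1 else 0 := by
  have hbm : b ∈ Finset.Icc 1 6 := by simp; omega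
  rw [hS.entry_eq hbm, hS.base_entry hbm, if_neg (by omega : ¬ b = 5),
    if_neg (by omega : ¬ b = 6), if_neg (by omega : ¬ (b = 4 ∧ _))]
  simp

theorem entry_four {a : ℕ} (ha : 1 ≤ a) (ha' : a ≤ 3) : ASmat 6 S a 4 = X (a, 4) := by
  rw [hS.entry_eq (by simp), hS.base_entry (by simp), if_neg (by omega : ¬ a = 4),
    if_pos ⟨rfl, hS.mem_base.2 ⟨ha, ha', rfl⟩⟩]
  simp

theorem entry_five {a : ℕ} (ha' : a ≤ 3) : ASmat 6 S a 5 =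
    ASmat 6 S a (j 1) * X (j 1, 5) + ASmat 6 S a (j 2) * X (j 2, 5) +
      ASmat 6 S a (j 3) * X (j 3, 5) := by
  have h4 : ∀ k, 1 ≤ k → k ≤ 4 → ASmat 6 S a k = ASmat 6 L a k := by
    intro k hk hk'
    rw [hS.entry_eq (by simp; omega), if_neg (by omega : ¬ k = 5), if_neg (by omega : ¬ k = 6)]
    simp
  have hj1 := hS.j_mem 1 (by omega) (by omega)
  have hj2 := hS.j_mem 2 (by omega) (by omega)
  have hj3 := hS.j_mem 3 (by omega) (by omega)
  rw [hS.entry_eq (by simp), hS.base_entry (by simp), h4 _ hj1.1 hj1.2, h4 _ hj2.1 hj2.2,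
    h4 _ hj3.1 hj3.2, if_neg (by omega : ¬ a = 5)]
  simp

theorem entry_six {a : ℕ} (ha' : a ≤ 3) : ASmat 6 S a 6 =
    ASmat 6 S a (i 1) * X (i 1, 6) + ASmat 6 S a (i 2) * X (i 2, 6) +
      ASmat 6 S a (i 3) * X (i 3, 6) := by
  conv_lhs => rw [hS.entry_eq (by simp), hS.base_entry (by simp), if_neg (by omega : ¬ a = 6)]
  simp

end IterData

theorem coe_Psi (m : (ℕ × ℕ) →₀ ℕ) :
    (Psi m : ℤ) = Finsupp.weight (fun β : ℕ × ℕ => (Ht β : ℤ)) m := by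
  simp [Psi, Finsupp.weight_apply, Finsupp.sum]

theorem phiStar_swap_left (S : List (ℕ × ℕ)) (a b c : ℕ) :
    phiStar 6 S ![b, a, c] = -phiStar 6 S ![a, b, c] := by
  simp only [phiStar, Matrix.det_fin_three, Matrix.of_apply]
  simp
  ring

theorem phiStar_swap_right (S : List (ℕ × ℕ)) (a b c : ℕ) :
    phiStar 6 S ![a, c, b] = -phiStar 6 S ![a, b, c] := by
  simp only [phiStar, Matrix.det_fin_three, Matrix.of_apply]
  simp
  ring

theorem phiStar_eq_zero_right (S : List (ℕ × ℕ)) (a c : ℕ) : phiStar 6 S ![a, c, c] = 0 := by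
  simp only [phiStar, Matrix.det_fin_three, Matrix.of_apply]
  simp

theorem phiStar_eq_zero_outer (S : List (ℕ × ℕ)) (a c : ℕ) : phiStar 6 S ![a, c, a] = 0 := by
  simp only [phiStar, Matrix.det_fin_three, Matrix.of_apply]
  simp

/-- If column `c` of `A_S` is a combination of three columns, expand the minor along it. -/
theorem phiStar_expand {S : List (ℕ × ℕ)} {c t₁ t₂ t₃ : ℕ} {u₁ u₂ u₃ : MvPolynomial (ℕ × ℕ) ℂ}
    (h : ∀ x ≤ 3, ASmat 6 S x c =
      ASmat 6 S x t₁ * u₁ + ASmat 6 S x t₂ * u₂ + ASmat 6 S x t₃ * u₃) (a b : ℕ) :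
    phiStar 6 S ![a, b, c] = u₁ * phiStar 6 S ![a, b, t₁] + u₂ * phiStar 6 S ![a, b, t₂] +
      u₃ * phiStar 6 S ![a, b, t₃] := by
  simp only [phiStar, Matrix.det_fin_three, Matrix.of_apply]
  simp [h]
  ring

theorem phiStar_isWeightedHomogeneous {S : List (ℕ × ℕ)} {w : ℕ × ℕ → ℤ} {g h : ℕ → ℤ}
    {K : Fin 3 → ℕ}
    (H : ∀ x, 1 ≤ x → x ≤ 3 → ∀ b : Fin 3,
      IsWeightedHomogeneous w (ASmat 6 S x (K b)) (g (K b) - h x)) :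
    IsWeightedHomogeneous w (phiStar 6 S K)
      (g (K 0) + g (K 1) + g (K 2) - h 1 - h 2 - h 3) := by
  rw [phiStar, Matrix.det_apply]
  refine IsWeightedHomogeneous.sum _ _ _ fun σ _ => ?_
  have key : IsWeightedHomogeneous w
      (∏ b : Fin 3, ASmat 6 S ((σ b).val + 1) (K b))
      (∑ b : Fin 3, (g (K b) - h ((σ b).val + 1))) :=
    IsWeightedHomogeneous.prod _ _ _ fun b _ => H _ (by omega) (by omega) b
  have hsum : (∑ b : Fin 3, (g (K b) - h ((σ b).val + 1))) =
      g (K 0) + g (K 1) + g (K 2) - h 1 - h 2 - h 3 := by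
    rw [Finset.sum_sub_distrib, Equiv.sum_comp σ (fun b : Fin 3 => h (b.val + 1))]
    simp [Fin.sum_univ_three]
    ring
  rw [hsum] at key
  rcases Int.units_eq_one_or (Equiv.Perm.sign σ) with hs | hs
  · simpa [hs] using key
  · rw [hs, Units.neg_smul, one_smul]
    exact (weightedHomogeneousSubmodule ℂ w _).neg_mem key

namespace IterData

variable {S : List (ℕ × ℕ)} {i j : ℕ → ℕ} {L : List (ℕ × ℕ)} (hS : IterData S i j L)
include hS

theorem entry_isWeightedHomogeneous {w : ℕ × ℕ → ℤ} {g h : ℕ → ℤ} {n : ℕ}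
    (hgh : ∀ x, 1 ≤ x → x ≤ 3 → g x = h x)
    (hw : ∀ x y, 1 ≤ x → x < y → y ≤ n → w (x, y) = g y - g x)
    {x b : ℕ} (hx : 1 ≤ x) (hx' : x ≤ 3) (hb : 1 ≤ b) (hbn : b ≤ n) (hn : n ≤ 6) :
    IsWeightedHomogeneous w (ASmat 6 S x b) (g b - h x) := by
  have h3 : ∀ b, 1 ≤ b → b ≤ 3 → IsWeightedHomogeneous w (ASmat 6 S x b) (g b - h x) := by
    intro b hb hb'
    rw [hS.entry_le_three hb hb']
    split_ifs with hxb
    · subst hxb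
      rw [hgh x hx hx', sub_self]
      exact isWeightedHomogeneous_one ℂ w
    · exact isWeightedHomogeneous_zero ℂ w _
  have h4 : ∀ b, 1 ≤ b → b ≤ 4 → b ≤ n → IsWeightedHomogeneous w (ASmat 6 S x b) (g b - h x) := by
    intro b hb hb' hbn
    obtain hlt | rfl : b ≤ 3 ∨ b = 4 := by omega
    · exact h3 b hb hlt
    · rw [hS.entry_four hx hx', ← hgh x hx hx', ← hw x 4 hx (by omega) hbn]
      exact isWeightedHomogeneous_X ℂ w _
  have step : ∀ t r, 1 ≤ t → t < r → r ≤ n → IsWeightedHomogeneous w (ASmat 6 S x t) (g t - h x) →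
      IsWeightedHomogeneous w (ASmat 6 S x t * X (t, r)) (g r - h x) := by
    intro t r ht htr hrn hA
    have := hA.mul (isWeightedHomogeneous_X ℂ w (t, r))
    rw [hw t r ht htr hrn] at this
    convert this using 1
    ring
  have h5 : ∀ b, 1 ≤ b → b ≤ 5 → b ≤ n → IsWeightedHomogeneous w (ASmat 6 S x b) (g b - h x) := by
    intro b hb hb' hbn
    obtain hlt | rfl : b ≤ 4 ∨ b = 5 := by omega
    · exact h4 b hb hlt hbn
    · rw [hS.entry_five hx']
      have hj : ∀ k, 1 ≤ k → k ≤ 3 →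
          IsWeightedHomogeneous w (ASmat 6 S x (j k) * X (j k, 5)) (g 5 - h x) := by
        intro k hk hk'
        have := hS.j_mem k hk hk'
        exact step _ _ this.1 (by omega) hbn (h4 _ this.1 this.2 (by omega))
      exact ((hj 1 (by omega) (by omega)).add (hj 2 (by omega) (by omega))).add
        (hj 3 (by omega) (by omega))
  obtain hlt | rfl : b ≤ 5 ∨ b = 6 := by omega
  · exact h5 b hb hlt hbn
  · rw [hS.entry_six hx']
    have hi : ∀ k, 1 ≤ k → k ≤ 3 →
        IsWeightedHomogeneous w (ASmat 6 S x (i k) * X (i k, 6)) (g 6 - h x) := by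
      intro k hk hk'
      have := hS.i_mem k hk hk'
      exact step _ _ this.1 (by omega) hbn (h5 _ this.1 this.2 (by omega))
    exact ((hi 1 (by omega) (by omega)).add (hi 2 (by omega) (by omega))).add
      (hi 3 (by omega) (by omega))

/-- All monomials of a minor have the same `Ψ_S`-value. -/
theorem Psi_of_mem_support {K : Fin 3 → ℕ} (hK : ∀ b, 1 ≤ K b ∧ K b ≤ 6)
    {m : (ℕ × ℕ) →₀ ℕ} (hm : m ∈ (phiStar 6 S K).support) :
    Psi m + 6 = K 0 + K 1 + K 2 := by
  have := phiStar_isWeightedHomogeneous (S := S) (w := fun β => (Ht β : ℤ)) (g := fun x => (x : ℤ))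
    (h := fun x => (x : ℤ)) (K := K) (fun x hx hx' b =>
      hS.entry_isWeightedHomogeneous (n := 6) (fun _ _ _ => rfl)
        (fun x y _ hxy _ => by simp [Ht]; omega) hx hx' (hK b).1 (hK b).2 le_rfl)
  have := this (mem_support_iff.1 hm)
  rw [← coe_Psi] at this
  push_cast at this
  omega

/-- A minor on the columns `< n` does not involve the variables `x_{·,n}`. -/
theorem apply_eq_zero_of_mem_support {K : Fin 3 → ℕ} {n : ℕ} (hn : n ≤ 6)
    (hK : ∀ b, 1 ≤ K b ∧ K b < n)
    {m : (ℕ × ℕ) →₀ ℕ} (hm : m ∈ (phiStar 6 S K).support) (x : ℕ) : m (x, n) = 0 := by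
  have := phiStar_isWeightedHomogeneous (S := S) (w := fun β => if β.2 = n then 1 else 0)
    (g := fun _ => 0) (h := fun _ => 0) (K := K) (fun x hx hx' b =>
      hS.entry_isWeightedHomogeneous (g := fun _ => 0) (h := fun _ => 0) (n := n - 1)
        (fun _ _ _ => rfl) (fun x y _ hxy hy => by rw [if_neg (by simp; omega)]; simp) hx hx'
          (hK b).1 (by have := hK b; omega) (by omega))
  have := this (mem_support_iff.1 hm)
  by_contra hne
  have hpos : (0 : ℤ) < m.sum fun β c => c • (if β.2 = n then (1 : ℤ) else 0) := by
    refine Finset.sum_pos' (fun β _ => by positivity) ⟨(x, n), by simpa using hne, ?_⟩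
    simp
    omega
  rw [Finsupp.weight_apply] at this
  omega

end IterData

/-- The index `k ≤ 3` with `x = t k`, and `4` if there is none. -/
def depth (t : ℕ → ℕ) (x : ℕ) : ℕ :=
  if x = t 0 then 0 else if x = t 1 then 1 else if x = t 2 then 2 else if x = t 3 then 3 else 4

theorem depth_le (t : ℕ → ℕ) (x : ℕ) : depth t x ≤ 4 := by
  unfold depth
  split_ifs <;> omega

theorem apply_depth {t : ℕ → ℕ} {x : ℕ} (h : depth t x < 4) : t (depth t x) = x := by
  unfold depth at *
  split_ifs at * <;> omega

theorem depth_apply {t : ℕ → ℕ} (ht : ∀ k l, k ≤ 3 → l ≤ 3 → t k = t l → k = l) {k : ℕ}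
    (hk : k ≤ 3) : depth t (t k) = k := by
  have h : depth t (t k) < 4 := by
    unfold depth
    interval_cases k <;> split_ifs <;> simp_all
  exact ht _ _ (by omega) hk (apply_depth h)

theorem depth_inj {t : ℕ → ℕ} {x y : ℕ} (hx : depth t x < 4) (h : depth t x = depth t y) :
    x = y := by
  rw [← apply_depth hx, h, apply_depth (t := t) (by omega)]

/-- The exponent of the variable `x_{x,n}`, where `x_{n,n}` is read as `1`. -/
noncomputable def unitExp (x n : ℕ) : (ℕ × ℕ) →₀ ℕ := if x = n then 0 else Finsupp.single (x, n) 1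

/-- The candidate for the valuation of the Plücker coordinate with complement `{r, q, p}`. -/
noncomputable def wt (r q p : ℕ) : (ℕ × ℕ) →₀ ℕ := unitExp r 6 + (unitExp q 5 + unitExp p 4)

theorem mem_of_distinct_four {a b c e x : ℕ} (ha : 1 ≤ a ∧ a ≤ 4) (hb : 1 ≤ b ∧ b ≤ 4)
    (hc : 1 ≤ c ∧ c ≤ 4) (he : 1 ≤ e ∧ e ≤ 4) (h : [a, b, c, e].Nodup) (hx : 1 ≤ x ∧ x ≤ 4) :
    x ∈ [a, b, c, e] := by
  have hsub : [a, b, c, e].toFinset ⊆ Finset.Icc 1 4 := by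
    intro y; simp; rintro (rfl | rfl | rfl | rfl) <;> assumption
  have := Finset.eq_of_subset_of_card_le hsub (by
    rw [List.toFinset_card_of_nodup h]; simp)
  rw [← List.mem_toFinset, this]
  simpa using hx

theorem mem_of_distinct_five {a b c e f x : ℕ} (ha : 1 ≤ a ∧ a ≤ 5) (hb : 1 ≤ b ∧ b ≤ 5)
    (hc : 1 ≤ c ∧ c ≤ 5) (he : 1 ≤ e ∧ e ≤ 5) (hf : 1 ≤ f ∧ f ≤ 5) (h : [a, b, c, e, f].Nodup)
    (hx : 1 ≤ x ∧ x ≤ 5) : x ∈ [a, b, c, e, f] := by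
  have hsub : [a, b, c, e, f].toFinset ⊆ Finset.Icc 1 5 := by
    intro y; simp; rintro (rfl | rfl | rfl | rfl | rfl) <;> assumption
  have := Finset.eq_of_subset_of_card_le hsub (by
    rw [List.toFinset_card_of_nodup h]; simp)
  rw [← List.mem_toFinset, this]
  simpa using hx

theorem exists_isLead_of_last {S : List (ℕ × ℕ)} {v : (ℕ × ℕ) →₀ ℕ} {n : ℕ} {Q : ℕ → ℕ → ℕ → Prop}
    (hQ₁ : ∀ a b c, Q a b c → Q b a c) (hQ₂ : ∀ a b c, Q a b c → Q a c b)
    (h : ∀ a b, Q a b n → ∃ s, IsLead S (phiStar 6 S ![a, b, n]) v s) {a b c : ℕ}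
    (hq : Q a b c) (hn : n = a ∨ n = b ∨ n = c) :
    ∃ s, IsLead S (phiStar 6 S ![a, b, c]) v s := by
  rcases hn with rfl | rfl | rfl
  · obtain ⟨s, hs⟩ := h _ _ (hQ₂ _ _ _ (hQ₁ _ _ _ hq))
    refine ⟨s, ?_⟩
    rw [phiStar_swap_left, phiStar_swap_right, neg_neg]
    exact hs
  · obtain ⟨s, hs⟩ := h _ _ (hQ₂ _ _ _ hq)
    exact ⟨-s, by rw [phiStar_swap_right]; exact hs.neg⟩
  · exact h _ _ hq

namespace IterData

variable {S : List (ℕ × ℕ)} {i j : ℕ → ℕ} {L : List (ℕ × ℕ)} (hS : IterData S i j L)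
include hS

theorem isLead_column {t : ℕ → ℕ} {n k idx a b : ℕ} {v : (ℕ × ℕ) →₀ ℕ} {s : ℂ} (hn : n ≤ 6)
    (ht : ∀ l, 1 ≤ l → l ≤ 3 → 1 ≤ t l ∧ t l < n)
    (hinj : ∀ k l, k ≤ 3 → l ≤ 3 → t k = t l → k = l)
    (hcol : ∀ x ≤ 3, ASmat 6 S x n = ASmat 6 S x (t 1) * X (t 1, n) +
      ASmat 6 S x (t 2) * X (t 2, n) + ASmat 6 S x (t 3) * X (t 3, n))
    (hk : 1 ≤ k) (hk' : k ≤ 3) (hidx : idx < S.length) (hSk : S.getD idx (0, 0) = (t k, n))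
    (hSl : ∀ m < idx, ∃ x y, S.getD m (0, 0) = (x, y) ∧ y ≤ 6 ∧
      (n < y ∨ (y = n ∧ ∃ l, 1 ≤ l ∧ l < k ∧ x = t l)))
    (ha : 1 ≤ a ∧ a < n) (hb : 1 ≤ b ∧ b < n)
    (hlt : ∀ l, 1 ≤ l → l < k → t l = a ∨ t l = b)
    (h : IsLead S (phiStar 6 S ![a, b, t k]) v s) :
    IsLead S (phiStar 6 S ![a, b, n]) (Finsupp.single (t k, n) 1 + v) s := by
  have hcols : ∀ l, 1 ≤ l → l ≤ 3 → ∀ e : Fin 3, 1 ≤ ![a, b, t l] e ∧ ![a, b, t l] e < n := by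
    intro l hl hl' e
    have := ht l hl hl'
    fin_cases e <;> simpa
  have hzero : ∀ l, 1 ≤ l → l < k → phiStar 6 S ![a, b, t l] = 0 := by
    intro l hl hl'
    rcases hlt l hl hl' with h | h <;> rw [h]
    · exact phiStar_eq_zero_outer S a b
    · exact phiStar_eq_zero_right S a b
  have hmain : IsLead S (X (t k, n) * phiStar 6 S ![a, b, t k])
      (Finsupp.single (t k, n) 1 + v) s := by
    have := (IsLead.monomial S (Finsupp.single (t k, n) 1) one_ne_zero).mul h
    rwa [one_mul] at this
  have hv : v ∈ (phiStar 6 S ![a, b, t k]).support := by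
    rw [mem_support_iff, h.2.1]; exact h.1
  have hbig : ∀ l, k < l → l ≤ 3 → ∀ m ∈ (X (t l, n) * phiStar 6 S ![a, b, t l]).support,
      psiLT S (Finsupp.single (t k, n) 1 + v) m := by
    classical
    intro l hl hl' m hm
    rw [support_X_mul, Finset.mem_map] at hm
    obtain ⟨m', hm', rfl⟩ := hm
    simp only [addLeftEmbedding_apply]
    have hc := hcols l (by omega) hl'
    have hc' := hcols k hk hk'
    have htl := ht l (by omega) hl'
    have htk := ht k hk hk'
    right
    constructor
    · have h1 := hS.Psi_of_mem_support (fun e => ⟨(hc e).1, by have := (hc e).2; omega⟩) hm'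
      have h2 := hS.Psi_of_mem_support (fun e => ⟨(hc' e).1, by have := (hc' e).2; omega⟩) hv
      simp only [Psi_add, Psi_single, Ht]
      simp at h1 h2 ⊢
      omega
    · have hne : t l ≠ t k := fun he => by
        have := hinj _ _ hl' hk' he
        omega
      refine ⟨idx, hidx, fun e he => ?_, ?_⟩
      · obtain ⟨x, y, hxy, hy, hxy'⟩ := hSl e he
        rw [hxy]
        have h1 := hS.apply_eq_zero_of_mem_support (n := y) hy
          (fun e => ⟨(hc e).1, by have := (hc e).2; omega⟩) hm' x
        have h2 := hS.apply_eq_zero_of_mem_support (n := y) hy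
          (fun e => ⟨(hc' e).1, by have := (hc' e).2; omega⟩) hv x
        rcases hxy' with hlt | ⟨rfl, l', hl1, hl2, rfl⟩
        · simp [h1, h2, hlt.ne]
        · have hn1 : t l ≠ t l' := fun he => by
            have := hinj _ _ hl' (by omega) he
            omega
          have hn2 : t k ≠ t l' := fun he => by
            have := hinj _ _ hk' (by omega) he
            omega
          simp [h1, h2, hn1, hn2]
      · rw [hSk]
        have h1 := hS.apply_eq_zero_of_mem_support hn hc hm' (t k)
        simp [h1, hne]
  rw [phiStar_expand hcol]
  interval_cases k
  · rw [add_assoc]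
    refine hmain.add fun m hm => ?_
    classical
    rcases Finset.mem_union.1 (support_add hm) with hm | hm
    · exact hbig 2 (by omega) (by omega) m hm
    · exact hbig 3 (by omega) (by omega) m hm
  · rw [hzero 1 (by omega) (by omega), mul_zero, zero_add]
    exact hmain.add fun m hm => hbig 3 (by omega) (by omega) m hm
  · rw [hzero 1 (by omega) (by omega), hzero 2 (by omega) (by omega)]
    simpa using hmain

theorem isLead_four {a b c p : ℕ} (ha : 1 ≤ a ∧ a ≤ 4) (hb : 1 ≤ b ∧ b ≤ 4)
    (hc : 1 ≤ c ∧ c ≤ 4) (hp : 1 ≤ p ∧ p ≤ 4) (hd : [a, b, c, p].Nodup) :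
    ∃ s, IsLead S (phiStar 6 S ![a, b, c]) (unitExp p 4) s := by
  by_cases hp4 : p = 4
  · subst hp4
    have hone : IsLead S 1 0 1 := IsLead.monomial S 0 one_ne_zero
    have key : phiStar 6 S ![a, b, c] = 1 ∨ phiStar 6 S ![a, b, c] = -1 := by
      simp only [phiStar, Matrix.det_fin_three, Matrix.of_apply]
      simp at hd
      obtain ⟨⟨hab, hac, ha4⟩, ⟨hbc, hb4⟩, hc4⟩ := hd
      simp [hS.entry_le_three ha.1 (by omega), hS.entry_le_three hb.1 (by omega),
        hS.entry_le_three hc.1 (by omega)]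
      have : a ≤ 3 := by omega
      have : b ≤ 3 := by omega
      have : c ≤ 3 := by omega
      obtain ⟨ha, -⟩ := ha
      obtain ⟨hb, -⟩ := hb
      obtain ⟨hc, -⟩ := hc
      interval_cases a <;> interval_cases b <;> interval_cases c <;> simp_all
    rw [unitExp, if_pos rfl]
    rcases key with h | h <;> rw [h]
    · exact ⟨1, hone⟩
    · exact ⟨-1, hone.neg⟩
  · refine exists_isLead_of_last (n := 4) (Q := fun a b c => (1 ≤ a ∧ a ≤ 4) ∧ (1 ≤ b ∧ b ≤ 4) ∧
      (1 ≤ c ∧ c ≤ 4) ∧ [a, b, c, p].Nodup) (fun a b c h => ?_) (fun a b c h => ?_) ?_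
      ⟨ha, hb, hc, hd⟩ ?_
    · refine ⟨h.2.1, h.1, h.2.2.1, ?_⟩
      have := h.2.2.2
      simp at this ⊢
      grind
    · refine ⟨h.1, h.2.2.1, h.2.1, ?_⟩
      have := h.2.2.2
      simp at this ⊢
      grind
    · rintro a b ⟨ha, hb, -, hd⟩
      have hone : IsLead S (X (p, 4)) (Finsupp.single (p, 4) 1) 1 :=
        IsLead.monomial S _ one_ne_zero
      simp at hd
      obtain ⟨⟨hab, ha4, hap⟩, ⟨hb4, hbp⟩, hp4'⟩ := hd
      have key : phiStar 6 S ![a, b, 4] = X (p, 4) ∨ phiStar 6 S ![a, b, 4] = -X (p, 4) := by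
        simp only [phiStar, Matrix.det_fin_three, Matrix.of_apply]
        simp [hS.entry_le_three ha.1 (by omega), hS.entry_le_three hb.1 (by omega),
          hS.entry_four]
        have : a ≤ 3 := by omega
        have : b ≤ 3 := by omega
        have : p ≤ 3 := by omega
        obtain ⟨ha, -⟩ := ha
        obtain ⟨hb, -⟩ := hb
        obtain ⟨hp, -⟩ := hp
        interval_cases a <;> interval_cases b <;> interval_cases p <;> simp_all
      rw [unitExp, if_neg hp4]
      rcases key with h | h <;> rw [h]
      · exact ⟨1, hone⟩
      · exact ⟨-1, hone.neg⟩
    · have := mem_of_distinct_four ha hb hc hp hd (x := 4) (by omega)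
      simp at this
      omega

theorem isLead_five {a b c q p : ℕ} (ha : 1 ≤ a ∧ a ≤ 5) (hb : 1 ≤ b ∧ b ≤ 5)
    (hc : 1 ≤ c ∧ c ≤ 5) (hq : 1 ≤ q ∧ q ≤ 5) (hp : 1 ≤ p ∧ p ≤ 5)
    (hd : [a, b, c, q, p].Nodup) (hqp : depth j q < depth j p) :
    ∃ s, IsLead S (phiStar 6 S ![a, b, c]) (unitExp q 5 + unitExp p 4) s := by
  have hp5 : p ≠ 5 := by
    rintro rfl
    have := depth_apply hS.j_inj (k := 0) (by omega)
    rw [hS.j_zero] at this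
    omega
  by_cases hq5 : q = 5
  · subst hq5
    rw [unitExp, if_pos rfl, zero_add]
    simp at hd
    exact hS.isLead_four (by omega) (by omega) (by omega) (by omega) (by simp; grind)
  · refine exists_isLead_of_last (n := 5) (Q := fun a b c => (1 ≤ a ∧ a ≤ 5) ∧ (1 ≤ b ∧ b ≤ 5) ∧
      (1 ≤ c ∧ c ≤ 5) ∧ [a, b, c, q, p].Nodup) (fun a b c h => ?_) (fun a b c h => ?_) ?_
      ⟨ha, hb, hc, hd⟩ ?_
    · refine ⟨h.2.1, h.1, h.2.2.1, ?_⟩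
      have := h.2.2.2
      simp at this ⊢
      grind
    · refine ⟨h.1, h.2.2.1, h.2.1, ?_⟩
      have := h.2.2.2
      simp at this ⊢
      grind
    · rintro a b ⟨ha, hb, -, hd⟩
      have hdp := depth_le j p
      have hqk : j (depth j q) = q := apply_depth (by omega)
      have hk : 1 ≤ depth j q := by
        by_contra h0
        rw [show depth j q = 0 by omega, hS.j_zero] at hqk
        omega
      simp at hd
      have hd4 : [a, b, q, p].Nodup := by simp; grind
      obtain ⟨s, hs⟩ := hS.isLead_four (a := a) (b := b) (c := q) (p := p) (by omega) (by omega)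
        (by omega) (by omega) hd4
      refine ⟨s, ?_⟩
      rw [unitExp, if_neg hq5]
      rw [← hqk] at hs ⊢
      refine hS.isLead_column (k := depth j q) (idx := 2 + depth j q) (by omega) ?_ hS.j_inj
        (fun x hx => hS.entry_five hx) hk (by omega) ?_ ?_ ?_ (by omega) (by omega) ?_ hs
      · intro l hl hl'
        have := hS.j_mem l hl hl'
        omega
      · rw [hS.eq]; simp; omega
      · rw [hS.eq]
        have : depth j q ≤ 3 := by omega
        generalize depth j q = k at *
        interval_cases k <;> rfl
      · rw [hS.eq]
        have : depth j q ≤ 3 := by omega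
        generalize depth j q = k at *
        intro m hm
        interval_cases k <;> interval_cases m <;> simp <;>
          first | exact ⟨1, by omega, by omega, rfl⟩ | exact ⟨2, by omega, by omega, rfl⟩
      · intro l hl hl'
        have hjl := hS.j_mem l hl (by omega)
        have hmem := mem_of_distinct_four (by omega) (by omega) (by omega) (by omega) hd4 hjl
        have hdl := depth_apply hS.j_inj (k := l) (by omega)
        simp at hmem
        rcases hmem with h | h | h | h
        · exact Or.inl h
        · exact Or.inr h
        · rw [h] at hdl; omega
        · rw [h] at hdl; omega
    · have := mem_of_distinct_five ha hb hc hq hp hd (x := 5) (by omega)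
      simp at this
      omega

theorem isLead_six {a b c r q p : ℕ} (ha : 1 ≤ a ∧ a ≤ 6) (hb : 1 ≤ b ∧ b ≤ 6)
    (hc : 1 ≤ c ∧ c ≤ 6) (hr : 1 ≤ r ∧ r ≤ 6) (hq : 1 ≤ q ∧ q ≤ 6) (hp : 1 ≤ p ∧ p ≤ 6)
    (hd : [a, b, c, r, q, p].Nodup) (hrq : depth i r < depth i q) (hrp : depth i r < depth i p)
    (hqp : depth j q < depth j p) :
    ∃ s, IsLead S (phiStar 6 S ![a, b, c]) (wt r q p) s := by
  have h6 : depth i 6 = 0 := by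
    have := depth_apply hS.i_inj (k := 0) (by omega)
    rwa [hS.i_zero] at this
  have hp6 : p ≠ 6 := by rintro rfl; omega
  have hq6 : q ≠ 6 := by rintro rfl; omega
  by_cases hr6 : r = 6
  · subst hr6
    rw [wt, unitExp, if_pos rfl, zero_add]
    simp at hd
    exact hS.isLead_five (by omega) (by omega) (by omega) (by omega) (by omega) (by simp; grind) hqp
  · refine exists_isLead_of_last (n := 6) (Q := fun a b c => (1 ≤ a ∧ a ≤ 6) ∧ (1 ≤ b ∧ b ≤ 6) ∧
      (1 ≤ c ∧ c ≤ 6) ∧ [a, b, c, r, q, p].Nodup) (fun a b c h => ?_) (fun a b c h => ?_) ?_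
      ⟨ha, hb, hc, hd⟩ ?_
    · refine ⟨h.2.1, h.1, h.2.2.1, ?_⟩
      have := h.2.2.2
      simp at this ⊢
      grind
    · refine ⟨h.1, h.2.2.1, h.2.1, ?_⟩
      have := h.2.2.2
      simp at this ⊢
      grind
    · rintro a b ⟨ha, hb, -, hd⟩
      have hdp := depth_le i p
      have hrk : i (depth i r) = r := apply_depth (by omega)
      have hk : 1 ≤ depth i r := by
        by_contra h0
        rw [show depth i r = 0 by omega, hS.i_zero] at hrk
        omega
      simp at hd
      have hd5 : [a, b, r, q, p].Nodup := by simp; grind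
      obtain ⟨s, hs⟩ := hS.isLead_five (a := a) (b := b) (c := r) (q := q) (p := p) (by omega)
        (by omega) (by omega) (by omega) (by omega) hd5 hqp
      refine ⟨s, ?_⟩
      rw [wt, unitExp, if_neg hr6]
      rw [← hrk] at hs ⊢
      refine hS.isLead_column (k := depth i r) (idx := depth i r - 1) (by omega) ?_ hS.i_inj
        (fun x hx => hS.entry_six hx) hk (by omega) ?_ ?_ ?_ (by omega) (by omega) ?_ hs
      · intro l hl hl'
        have := hS.i_mem l hl hl'
        omega
      · rw [hS.eq]; simp; omega
      · rw [hS.eq]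
        have : depth i r ≤ 3 := by omega
        generalize depth i r = k at *
        interval_cases k <;> rfl
      · rw [hS.eq]
        have : depth i r ≤ 3 := by omega
        generalize depth i r = k at *
        intro m hm
        interval_cases k <;> interval_cases m <;> simp <;>
          first | exact ⟨1, by omega, by omega, rfl⟩ | exact ⟨2, by omega, by omega, rfl⟩
      · intro l hl hl'
        have hil := hS.i_mem l hl (by omega)
        have hmem := mem_of_distinct_five (by omega) (by omega) (by omega) (by omega) (by omega)
          hd5 hil
        have hdl := depth_apply hS.i_inj (k := l) (by omega)
        simp at hmem
        rcases hmem with h | h | h | h | h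
        · exact Or.inl h
        · exact Or.inr h
        · rw [h] at hdl; omega
        · rw [h] at hdl; omega
        · rw [h] at hdl; omega
    · have : (6 : ℕ) ∈ [a, b, c, r, q, p] := by
        by_contra h6
        have hsub : (6 :: [a, b, c, r, q, p]).toFinset ⊆ Finset.Icc 1 6 := by
          intro y; simp; rintro (rfl | rfl | rfl | rfl | rfl | rfl | rfl) <;> omega
        have := Finset.card_le_card hsub
        rw [List.toFinset_card_of_nodup (List.nodup_cons.2 ⟨h6, hd⟩)] at this
        simp at this
      simp at this
      omega

end IterData

/-- `{r, q, p}` is a three-element subset of `{1,…,6}`, listed in the order in which its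
elements occur in the leading monomial of the complementary minor. -/
structure Valid (i j : ℕ → ℕ) (r q p : ℕ) : Prop where
  r_mem : 1 ≤ r ∧ r ≤ 6
  q_mem : 1 ≤ q ∧ q ≤ 6
  p_mem : 1 ≤ p ∧ p ≤ 6
  r_lt_q : depth i r < depth i q
  r_lt_p : depth i r < depth i p
  q_lt_p : depth j q < depth j p

theorem Valid.nodup {i j : ℕ → ℕ} {r q p : ℕ} (h : Valid i j r q p) : [r, q, p].Nodup := by
  obtain ⟨-, -, -, h1, h2, h3⟩ := h
  simp
  refine ⟨⟨?_, ?_⟩, ?_⟩ <;> rintro rfl <;> omega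

theorem Valid.r_eq {i j : ℕ → ℕ} {r q p a b c : ℕ} (h : Valid i j r q p)
    (hp : [r, q, p].Perm [a, b, c]) (hb : depth i a < depth i b) (hc : depth i a < depth i c) :
    r = a ∧ [q, p].Perm [b, c] := by
  have hra : r = a := by
    have h1 : a ∈ [r, q, p] := hp.mem_iff.2 (by simp)
    have h2 : r ∈ [a, b, c] := hp.mem_iff.1 (by simp)
    have := h.r_lt_q
    have := h.r_lt_p
    simp at h1 h2
    rcases h1 with rfl | rfl | rfl
    · rfl
    all_goals rcases h2 with rfl | rfl | rfl <;> omega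
  subst hra
  exact ⟨rfl, (List.perm_cons _).1 hp⟩

theorem lt_depth_of_perm {i : ℕ → ℕ} {r q p a b c k : ℕ}
    (hp : [r, q, p].Perm [a, b, c]) (ha : k < depth i a) (hb : k < depth i b)
    (hc : k < depth i c) : k < depth i r := by
  have h2 : r ∈ [a, b, c] := hp.mem_iff.1 (by simp)
  simp at h2
  rcases h2 with rfl | rfl | rfl <;> assumption

theorem Valid.q_eq {i j : ℕ → ℕ} {r q p b c : ℕ} (h : Valid i j r q p)
    (hp : [q, p].Perm [b, c]) (hb : depth j b < depth j c) : q = b ∧ p = c := by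
  have h1 : b ∈ [q, p] := hp.mem_iff.2 (by simp)
  have h2 : q ∈ [b, c] := hp.mem_iff.1 (by simp)
  have := h.q_lt_p
  have hq : q = b := by
    simp at h1 h2
    rcases h1 with rfl | rfl
    · rfl
    · rcases h2 with rfl | rfl <;> omega
  subst hq
  exact ⟨rfl, by simpa using hp⟩

theorem Valid.unique {i j : ℕ → ℕ} {r q p r' q' p' : ℕ} (h : Valid i j r q p)
    (h' : Valid i j r' q' p') (hp : [r, q, p].Perm [r', q', p']) : r = r' ∧ q = q' ∧ p = p' := by
  obtain ⟨h1, h2⟩ := h.r_eq hp h'.r_lt_q h'.r_lt_p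
  exact ⟨h1, h.q_eq h2 h'.q_lt_p⟩

theorem length_le_of_nodup {l : List ℕ} {n : ℕ} (h : l.Nodup) (hl : ∀ x ∈ l, 1 ≤ x ∧ x ≤ n) :
    l.length ≤ n := by
  rw [← List.toFinset_card_of_nodup h]
  refine (Finset.card_le_card (t := Finset.Icc 1 n) fun x hx => ?_).trans (by simp)
  simpa using hl x (by simpa using hx)

theorem depth_ne {i : ℕ → ℕ} {x y : ℕ} (hxy : x ≠ y) (h : depth i x < 4 ∨ depth i y < 4) :
    depth i x ≠ depth i y := by
  intro he
  rcases h with h | h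
  · exact hxy (depth_inj h he)
  · exact hxy (depth_inj h he.symm).symm

namespace IterData

variable {S : List (ℕ × ℕ)} {i j : ℕ → ℕ} {L : List (ℕ × ℕ)} (hS : IterData S i j L)
include hS

theorem depth_i_six : depth i 6 = 0 := by
  have := depth_apply hS.i_inj (k := 0) (by omega)
  rwa [hS.i_zero] at this

theorem depth_j_five : depth j 5 = 0 := by
  have := depth_apply hS.j_inj (k := 0) (by omega)
  rwa [hS.j_zero] at this

theorem i_mem' {k : ℕ} (hk : k ≤ 3) : 1 ≤ i k ∧ i k ≤ 6 := by
  rcases Nat.eq_zero_or_pos k with rfl | h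
  · rw [hS.i_zero]; omega
  · have := hS.i_mem k h hk; omega

theorem j_mem' {k : ℕ} (hk : k ≤ 3) : 1 ≤ j k ∧ j k ≤ 5 := by
  rcases Nat.eq_zero_or_pos k with rfl | h
  · rw [hS.j_zero]; omega
  · have := hS.j_mem k h hk; omega

theorem depth_j_ne {x y : ℕ} (hxy : x ≠ y) (hx : 1 ≤ x ∧ x ≤ 5) (hy : 1 ≤ y ∧ y ≤ 5) :
    depth j x ≠ depth j y := by
  intro he
  have h4 : depth j x = 4 := by
    by_contra h
    have := depth_le j x
    exact hxy (depth_inj (by omega) he)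
  have hne : ∀ k ≤ 3, ∀ z, depth j z = 4 → j k ≠ z := by
    rintro k hk z hz rfl
    rw [depth_apply hS.j_inj hk] at hz
    omega
  have hjj : ∀ k l, k ≤ 3 → l ≤ 3 → k ≠ l → j k ≠ j l :=
    fun k l hk hl hkl h => hkl (hS.j_inj k l hk hl h)
  have := length_le_of_nodup (l := [j 0, j 1, j 2, j 3, x, y]) (n := 5) (by
    simp [hxy, hne _ _ _ h4, hne _ _ _ (he ▸ h4), hjj]) (by
    have := fun k hk => hS.j_mem' (k := k) hk
    simp [*])
  simp at this

theorem exists_depth_i_lt {x y z : ℕ} (hx : 1 ≤ x ∧ x ≤ 6) (hy : 1 ≤ y ∧ y ≤ 6)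
    (hz : 1 ≤ z ∧ z ≤ 6) (hd : [x, y, z].Nodup) :
    depth i x < 4 ∨ depth i y < 4 ∨ depth i z < 4 := by
  by_contra! hcon
  have hne : ∀ k ≤ 3, ∀ z, 4 ≤ depth i z → i k ≠ z := by
    rintro k hk z hz rfl
    rw [depth_apply hS.i_inj hk] at hz
    omega
  have hii : ∀ k l, k ≤ 3 → l ≤ 3 → k ≠ l → i k ≠ i l :=
    fun k l hk hl hkl h => hkl (hS.i_inj k l hk hl h)
  simp at hd
  have := length_le_of_nodup (l := [i 0, i 1, i 2, i 3, x, y, z]) (n := 6) (by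
    simp [hne _ _ _ hcon.1, hne _ _ _ hcon.2.1, hne _ _ _ hcon.2.2, hii, hd]) (by
    have := fun k hk => hS.i_mem' (k := k) hk
    simp [*])
  simp at this

theorem valid_of_depth_lt {x y z : ℕ} (hx : 1 ≤ x ∧ x ≤ 6) (hy : 1 ≤ y ∧ y ≤ 6)
    (hz : 1 ≤ z ∧ z ≤ 6) (hyz : y ≠ z) (hxy : depth i x < depth i y)
    (hxz : depth i x < depth i z) :
    Valid i j x y z ∨ Valid i j x z y := by
  have h6 := hS.depth_i_six
  have hy6 : y ≠ 6 := by rintro rfl; omega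
  have hz6 : z ≠ 6 := by rintro rfl; omega
  rcases lt_or_gt_of_ne (hS.depth_j_ne hyz (by omega) (by omega)) with h | h
  · exact Or.inl ⟨hx, hy, hz, hxy, hxz, h⟩
  · exact Or.inr ⟨hx, hz, hy, hxz, hxy, h⟩

theorem exists_valid_perm {x y z : ℕ} (hx : 1 ≤ x ∧ x ≤ 6) (hy : 1 ≤ y ∧ y ≤ 6)
    (hz : 1 ≤ z ∧ z ≤ 6) (hd : [x, y, z].Nodup) :
    ∃ r q p, Valid i j r q p ∧ [r, q, p].Perm [x, y, z] := by
  have hlt := hS.exists_depth_i_lt hx hy hz hd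
  simp at hd
  obtain ⟨⟨hxy, hxz⟩, hyz⟩ := hd
  have h4x := depth_le i x
  have h4y := depth_le i y
  have h4z := depth_le i z
  have h1 := depth_ne (i := i) hxy
  have h2 := depth_ne (i := i) hxz
  have h3 := depth_ne (i := i) hyz
  have hmin : (depth i x < depth i y ∧ depth i x < depth i z) ∨
      (depth i y < depth i x ∧ depth i y < depth i z) ∨
      (depth i z < depth i x ∧ depth i z < depth i y) := by omega
  have p1 : [y, x, z].Perm [x, y, z] := List.Perm.swap _ _ _
  have p2 : [x, z, y].Perm [x, y, z] := (List.Perm.swap _ _ _).cons _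
  have p3 : [y, z, x].Perm [x, y, z] := ((List.Perm.swap _ _ _).cons _).trans p1
  have p4 : [z, x, y].Perm [x, y, z] := (List.Perm.swap _ _ _).trans p2
  have p5 : [z, y, x].Perm [x, y, z] := ((List.Perm.swap _ _ _).cons _).trans p4
  rcases hmin with ⟨ha, hb⟩ | ⟨ha, hb⟩ | ⟨ha, hb⟩
  · rcases hS.valid_of_depth_lt hx hy hz hyz ha hb with h | h
    · exact ⟨_, _, _, h, List.Perm.refl _⟩
    · exact ⟨_, _, _, h, p2⟩
  · rcases hS.valid_of_depth_lt hy hx hz hxz ha hb with h | h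
    · exact ⟨_, _, _, h, p1⟩
    · exact ⟨_, _, _, h, p3⟩
  · rcases hS.valid_of_depth_lt hz hx hy hxy ha hb with h | h
    · exact ⟨_, _, _, h, p4⟩
    · exact ⟨_, _, _, h, p5⟩

end IterData

/-- The set of columns of a Plücker coordinate. -/
def cols (K : MI 6) : Finset ℕ := Finset.univ.image K.1

theorem cols_injective : Function.Injective cols := by
  intro K K' h
  refine Subtype.ext ((StrictMono.range_inj K.2.1 K'.2.1).1 ?_)
  have := congrArg (fun F : Finset ℕ => (F : Set ℕ)) h
  simpa [cols] using this

theorem card_cols (K : MI 6) : (cols K).card = 3 := by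
  rw [cols, Finset.card_image_of_injective _ K.2.1.injective]; simp

theorem cols_subset (K : MI 6) : cols K ⊆ Finset.Icc 1 6 := by
  intro x hx
  obtain ⟨a, -, rfl⟩ := Finset.mem_image.1 hx
  simpa using K.2.2 a

theorem exists_sorted_image {k : ℕ} {F : Finset ℕ} (h : F.card = k) (hF : F ⊆ Finset.Icc 1 6) :
    ∃ I : Fin k → ℕ, Sorted k 6 I ∧ Finset.univ.image I = F := by
  refine ⟨F.orderEmbOfFin h, ⟨(F.orderEmbOfFin h).strictMono, fun a => ?_⟩, by simp⟩
  simpa using hF (F.orderEmbOfFin_mem h a)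

theorem exists_cols_eq {F : Finset ℕ} (h : F.card = 3) (hF : F ⊆ Finset.Icc 1 6) :
    ∃ K, cols K = F := by
  obtain ⟨I, hI, hIF⟩ := exists_sorted_image h hF
  exact ⟨⟨I, hI⟩, hIF⟩

/-- The functions `r, q, p` list the complement of a Plücker coordinate in the order of its
leading monomial. -/
structure ValData (i j : ℕ → ℕ) (r q p : MI 6 → ℕ) : Prop where
  valid : ∀ K, Valid i j (r K) (q K) (p K)
  compl : ∀ K, [r K, q K, p K].toFinset = Finset.Icc 1 6 \ cols K

namespace ValData

variable {i j : ℕ → ℕ} {r q p : MI 6 → ℕ} (hV : ValData i j r q p)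
include hV

theorem inj {K K' : MI 6} (hr : r K = r K') (hq : q K = q K') (hp : p K = p K') : K = K' := by
  have h1 := hV.compl K
  have h2 := hV.compl K'
  rw [hr, hq, hp, h2] at h1
  apply cols_injective
  rw [← Finset.sdiff_sdiff_eq_self (cols_subset K), ← h1,
    Finset.sdiff_sdiff_eq_self (cols_subset K')]

theorem perm_of_compl {K : MI 6} {a b c : ℕ} (hd : [a, b, c].Nodup)
    (h : [a, b, c].toFinset = Finset.Icc 1 6 \ cols K) : [r K, q K, p K].Perm [a, b, c] := by
  rw [← hV.compl K] at h
  exact (List.perm_of_nodup_nodup_toFinset_eq hd (hV.valid K).nodup h).symm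

theorem surj {r' q' p' : ℕ} (h : Valid i j r' q' p') : ∃ K, r K = r' ∧ q K = q' ∧ p K = p' := by
  have hsub : [r', q', p'].toFinset ⊆ Finset.Icc 1 6 := by
    have := h.r_mem
    have := h.q_mem
    have := h.p_mem
    intro y; simp; rintro (rfl | rfl | rfl) <;> assumption
  obtain ⟨K, hK⟩ := exists_cols_eq (F := Finset.Icc 1 6 \ [r', q', p'].toFinset) (by
    rw [Finset.card_sdiff_of_subset hsub, List.toFinset_card_of_nodup h.nodup]; simp)
    Finset.sdiff_subset
  refine ⟨K, (hV.valid K).unique h (hV.perm_of_compl h.nodup ?_)⟩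
  rw [hK, Finset.sdiff_sdiff_eq_self hsub]

end ValData

namespace IterData

variable {S : List (ℕ × ℕ)} {i j : ℕ → ℕ} {L : List (ℕ × ℕ)} (hS : IterData S i j L)
include hS

theorem exists_valData : ∃ r q p, ValData i j r q p := by
  have key : ∀ K : MI 6, ∃ r q p, Valid i j r q p ∧
      [r, q, p].toFinset = Finset.Icc 1 6 \ cols K := by
    intro K
    have hc : (Finset.Icc 1 6 \ cols K).card = 3 := by
      rw [Finset.card_sdiff_of_subset (cols_subset K), card_cols]; simp
    obtain ⟨x, y, z, hxy, hxz, hyz, h⟩ := Finset.card_eq_three.1 hc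
    have hm : ∀ w ∈ ({x, y, z} : Finset ℕ), 1 ≤ w ∧ w ≤ 6 := by
      intro w hw
      rw [← h] at hw
      simpa using (Finset.mem_sdiff.1 hw).1
    obtain ⟨r, q, p, hv, hp⟩ := hS.exists_valid_perm (hm x (by simp)) (hm y (by simp))
      (hm z (by simp)) (by simp [hxy, hxz, hyz])
    exact ⟨r, q, p, hv, by rw [h, List.toFinset_eq_of_perm _ _ hp]; simp⟩
  choose r q p hv hc using key
  exact ⟨r, q, p, hv, hc⟩

theorem exists_isLead {r q p : MI 6 → ℕ} (hV : ValData i j r q p) (K : MI 6) :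
    ∃ s, IsLead S (phiStar 6 S K.1) (wt (r K) (q K) (p K)) s := by
  have hv := hV.valid K
  have hK : (K : Fin 3 → ℕ) = ![K.1 0, K.1 1, K.1 2] := by
    ext a; fin_cases a <;> rfl
  rw [hK]
  refine hS.isLead_six (K.2.2 0) (K.2.2 1) (K.2.2 2) hv.r_mem hv.q_mem hv.p_mem ?_ hv.r_lt_q
    hv.r_lt_p hv.q_lt_p
  have hc : ∀ x ∈ [r K, q K, p K], ∀ a, K.1 a ≠ x := by
    rintro x hx a rfl
    rw [← List.mem_toFinset, hV.compl, Finset.mem_sdiff] at hx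
    exact hx.2 (Finset.mem_image_of_mem _ (Finset.mem_univ _))
  have hn := hv.nodup
  simp at hc hn ⊢
  have h01 := K.2.1 (show (0 : Fin 3) < 1 by decide)
  have h12 := K.2.1 (show (1 : Fin 3) < 2 by decide)
  refine ⟨⟨h01.ne, (h01.trans h12).ne, ?_⟩, ⟨h12.ne, ?_⟩, ?_, hn⟩ <;>
    exact ⟨hc.1 _, hc.2.1 _, hc.2.2 _⟩

theorem exists_isLead_valS {r q p : MI 6 → ℕ} (hV : ValData i j r q p) :
    (∀ K : MI 6, valS 6 S K.1 = wt (r K) (q K) (p K)) ∧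
      ∃ s : MI 6 → ℂ, ∀ K : MI 6, IsLead S (phiStar 6 S K.1) (valS 6 S K.1) (s K) := by
  have h : ∀ K : MI 6, valS 6 S K.1 = wt (r K) (q K) (p K) := by
    intro K
    obtain ⟨s, hs⟩ := hS.exists_isLead hV K
    exact hs.minSupp_eq
  refine ⟨h, ?_⟩
  have := hS.exists_isLead hV
  simp only [← h] at this
  exact Classical.skolem.1 this

end IterData

open scoped Classical in
/-- The Plücker variable indexed by a set of columns. -/
noncomputable def pset (F : Finset ℕ) : PRing 6 := if h : ∃ K, cols K = F then X h.choose else 0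

theorem pset_cols (K : MI 6) : pset (cols K) = X K := by
  have h : ∃ K', cols K' = cols K := ⟨K, rfl⟩
  rw [pset, dif_pos h, cols_injective h.choose_spec]

theorem pvar_of_sorted {K : Fin 3 → ℕ} (h : Sorted 3 6 K) : pvar 6 K = X (⟨K, h⟩ : MI 6) := by
  rw [pvar, dif_pos h]

theorem pvar_eq_pset {K : Fin 3 → ℕ} (h : Sorted 3 6 K) :
    pvar 6 K = pset (Finset.univ.image K) := by
  rw [pvar_of_sorted h, ← pset_cols]; rfl

theorem sorted_three {n a b c : ℕ} (ha : 1 ≤ a) (hab : a < b) (hbc : b < c) (hc : c ≤ n) :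
    Sorted 3 n ![a, b, c] := by
  refine ⟨?_, ?_⟩
  · intro x y hxy
    fin_cases x <;> fin_cases y <;> simp at hxy ⊢ <;> omega
  · intro x
    fin_cases x <;> simp <;> omega

theorem univ_image_three (a b c : ℕ) :
    Finset.univ.image ![a, b, c] = ({a, b, c} : Finset ℕ) := by
  ext x
  simp [Fin.exists_fin_succ, eq_comm]

section

variable {I : Fin 2 → ℕ}

theorem insert3_of_lt {j : ℕ} (h : I 0 < I 1) (hj : j < I 0) : insert3 I j = ![j, I 0, I 1] := by
  have h1 : ¬ I 1 ≤ j := by omega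
  have h2 : ¬ I 0 ≤ j := by omega
  ext a
  fin_cases a <;> simp [insert3, h1, h2, h.le]

theorem insert3_of_mem {j : ℕ} (h1 : I 0 < j) (h2 : j < I 1) :
    insert3 I j = ![I 0, j, I 1] := by
  have h1' : ¬ I 1 ≤ j := by omega
  ext a
  fin_cases a <;> simp [insert3, h1', h1.le]

theorem insert3_of_gt {j : ℕ} (h : I 0 < I 1) (hj : I 1 < j) : insert3 I j = ![I 0, I 1, j] := by
  ext a
  fin_cases a <;> simp [insert3, hj.le, h.le]

theorem pvar_insert3_self {j : ℕ} (h : I 0 < I 1) (hj : j = I 0 ∨ j = I 1) :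
    pvar 6 (insert3 I j) = 0 := by
  rw [pvar, dif_neg]
  rintro ⟨hm, -⟩
  have h01 := hm (show (0 : Fin 3) < 1 by decide)
  have h12 := hm (show (1 : Fin 3) < 2 by decide)
  rcases hj with rfl | rfl
  · have h1' : ¬ I 1 ≤ I 0 := by omega
    simp [insert3, h1'] at h01
  · simp [insert3, h.le] at h12

theorem pvar_insert3 {j : ℕ} (hI : Sorted 2 6 I) (hj : 1 ≤ j ∧ j ≤ 6)
    (hjI : j ∉ Finset.univ.image I) :
    pvar 6 (insert3 I j) = pset (insert j (Finset.univ.image I)) := by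
  have h := hI.1 (show (0 : Fin 2) < 1 by decide)
  have h0 := hI.2 0
  have h1 := hI.2 1
  have himg : Finset.univ.image I = {I 0, I 1} := by
    ext x; simp [Fin.exists_fin_two, eq_comm]
  rw [himg] at hjI ⊢
  simp at hjI
  obtain hlt | ⟨hlt, hlt'⟩ | hlt : j < I 0 ∨ (I 0 < j ∧ j < I 1) ∨ I 1 < j := by omega
  · rw [insert3_of_lt h hlt, pvar_eq_pset (sorted_three hj.1 hlt h h1.2), univ_image_three]
  · rw [insert3_of_mem hlt hlt', pvar_eq_pset (sorted_three h0.1 hlt hlt' h1.2), univ_image_three,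
      Finset.insert_comm]
  · rw [insert3_of_gt h hlt, pvar_eq_pset (sorted_three h0.1 h hlt hj.2), univ_image_three]
    congr 1
    ext x
    simp
    tauto

end

section

variable {J : Fin 4 → ℕ}

theorem erase4_zero : erase4 J (J 0) = ![J 1, J 2, J 3] := by
  ext a
  fin_cases a <;> simp [erase4]

theorem erase4_one (hJ : StrictMono J) : erase4 J (J 1) = ![J 0, J 2, J 3] := by
  have h01 := hJ (show (0 : Fin 4) < 1 by decide)
  ext a
  fin_cases a <;> simp [erase4, h01.ne]

theorem erase4_two (hJ : StrictMono J) : erase4 J (J 2) = ![J 0, J 1, J 3] := by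
  have h02 := hJ (show (0 : Fin 4) < 2 by decide)
  have h12 := hJ (show (1 : Fin 4) < 2 by decide)
  ext a
  fin_cases a <;> simp [erase4, h02.ne, h12.ne]

theorem erase4_three (hJ : StrictMono J) : erase4 J (J 3) = ![J 0, J 1, J 2] := by
  have h03 := hJ (show (0 : Fin 4) < 3 by decide)
  have h13 := hJ (show (1 : Fin 4) < 3 by decide)
  have h23 := hJ (show (2 : Fin 4) < 3 by decide)
  ext a
  fin_cases a <;> simp [erase4, h03.ne, h13.ne, h23.ne]

theorem pvar_erase4 (hJ : Sorted 4 6 J) (a : Fin 4) :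
    pvar 6 (erase4 J (J a)) = pset ((Finset.univ.image J).erase (J a)) := by
  have h01 := hJ.1 (show (0 : Fin 4) < 1 by decide)
  have h12 := hJ.1 (show (1 : Fin 4) < 2 by decide)
  have h23 := hJ.1 (show (2 : Fin 4) < 3 by decide)
  have h0 := hJ.2 0
  have h1 := hJ.2 1
  have h2 := hJ.2 2
  have h3 := hJ.2 3
  fin_cases a
  · rw [Fin.zero_eta, erase4_zero, pvar_eq_pset (sorted_three (by omega) h12 h23 (by omega)),
      univ_image_three]
    congr 1; ext x; simp [Fin.exists_fin_succ, eq_comm]; omega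
  · rw [Fin.mk_one, erase4_one hJ.1,
      pvar_eq_pset (sorted_three (by omega) (h01.trans h12) h23 (by omega)), univ_image_three]
    congr 1; ext x; simp [Fin.exists_fin_succ, eq_comm]; omega
  · rw [show (⟨2, by omega⟩ : Fin 4) = 2 from rfl, erase4_two hJ.1,
      pvar_eq_pset (sorted_three (by omega) h01 (h12.trans h23) (by omega)), univ_image_three]
    congr 1; ext x; simp [Fin.exists_fin_succ, eq_comm]; omega
  · rw [show (⟨3, by omega⟩ : Fin 4) = 3 from rfl, erase4_three hJ.1,
      pvar_eq_pset (sorted_three (by omega) h01 h12 (by omega)), univ_image_three]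
    congr 1; ext x; simp [Fin.exists_fin_succ, eq_comm]; omega

end

/-- A Plücker relation, indexed by sets of columns. -/
theorem exists_Rrel_eq {I J : Finset ℕ} (hI : I.card = 2) (hJ : J.card = 4)
    (hI6 : I ⊆ Finset.Icc 1 6) (hJ6 : J ⊆ Finset.Icc 1 6) :
    ∃ I' J' , ∃ ε : ℕ → ℂ, Sorted 2 6 I' ∧ Sorted 4 6 J' ∧ (∀ z, ε z ≠ 0) ∧
      Rrel 6 I' J' = ∑ z ∈ J \ I, C (ε z) * (pset (insert z I) * pset (J.erase z)) := by
  obtain ⟨I', hI', rfl⟩ := exists_sorted_image hI hI6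
  obtain ⟨J', hJ', rfl⟩ := exists_sorted_image hJ hJ6
  refine ⟨I', J', fun z => (-1) ^ ((Finset.univ.filter fun b : Fin 2 => I' b < z).card +
        (Finset.univ.filter fun b : Fin 4 => z < J' b).card), hI', hJ', fun z => by simp, ?_⟩
  rw [Finset.sum_subset_zero_on_sdiff (s₂ := Finset.univ.image J')
    (g := fun z => (-1 : PRing 6) ^ ((Finset.univ.filter fun b : Fin 2 => I' b < z).card +
        (Finset.univ.filter fun b : Fin 4 => z < J' b).card) *
      (pvar 6 (insert3 I' z) * pvar 6 (erase4 J' z))) Finset.sdiff_subset,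
      Finset.sum_image fun a _ b _ h => hJ'.1.injective h]
  · rfl
  · intro z hz
    have hz' : z ∈ Finset.univ.image I' := by simp at hz ⊢; grind
    rw [pvar_insert3_self (hI'.1 (by decide)), zero_mul, mul_zero]
    simpa [Fin.exists_fin_two, eq_comm] using hz'
  · intro z hz
    rw [Finset.mem_sdiff] at hz
    have hz6 := hJ6 hz.1
    obtain ⟨a, -, rfl⟩ := Finset.mem_image.1 hz.1
    rw [pvar_insert3 hI' (by simpa using hz6) hz.2, pvar_erase4 hJ']
    simp

/-- The homogenized pullback: `p_K ↦ t · φ_S^*(p̄_K)`, with `x_{0,0}` in the role of `t`. -/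
noncomputable def pullback (S : List (ℕ × ℕ)) : PRing 6 →ₐ[ℂ] MvPolynomial (ℕ × ℕ) ℂ :=
  aeval fun K : MI 6 => X (0, 0) * phiStar 6 S K.1

theorem phiStar_exchange (S : List (ℕ × ℕ)) (a b c₀ c₁ c₂ c₃ : ℕ) :
    -(phiStar 6 S ![a, b, c₀] * phiStar 6 S ![c₁, c₂, c₃]) +
      phiStar 6 S ![a, b, c₁] * phiStar 6 S ![c₀, c₂, c₃] -
      phiStar 6 S ![a, b, c₂] * phiStar 6 S ![c₀, c₁, c₃] +
      phiStar 6 S ![a, b, c₃] * phiStar 6 S ![c₀, c₁, c₂] = 0 := by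
  simp only [phiStar, Matrix.det_fin_three, Matrix.of_apply]
  simp
  ring

section

variable {S : List (ℕ × ℕ)}

theorem pullback_pvar {K : Fin 3 → ℕ} (h : Sorted 3 6 K) :
    pullback S (pvar 6 K) = X (0, 0) * phiStar 6 S K := by
  rw [pvar_of_sorted h, pullback, aeval_X]

theorem pullback_insert3 {I : Fin 2 → ℕ} (hI : Sorted 2 6 I) {z : ℕ} (hz : 1 ≤ z ∧ z ≤ 6) :
    pullback S (pvar 6 (insert3 I z)) =
      (-1) ^ (Finset.univ.filter fun b : Fin 2 => I b < z).card *
        (X (0, 0) * phiStar 6 S ![I 0, I 1, z]) := by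
  have h := hI.1 (show (0 : Fin 2) < 1 by decide)
  have h0 := hI.2 0
  have h1 := hI.2 1
  rw [Finset.card_filter, Fin.sum_univ_two]
  obtain hlt | rfl | ⟨hlt, hlt'⟩ | rfl | hlt :
    z < I 0 ∨ z = I 0 ∨ (I 0 < z ∧ z < I 1) ∨ z = I 1 ∨ I 1 < z := by omega
  · rw [insert3_of_lt h hlt, pullback_pvar (sorted_three hz.1 hlt h h1.2),
      if_neg (by omega), if_neg (by omega), phiStar_swap_left, phiStar_swap_right]
    ring
  · rw [pvar_insert3_self h (Or.inl rfl), phiStar_eq_zero_outer]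
    simp
  · rw [insert3_of_mem hlt hlt', pullback_pvar (sorted_three h0.1 hlt hlt' h1.2),
      if_pos hlt, if_neg (by omega), phiStar_swap_right]
    ring
  · rw [pvar_insert3_self h (Or.inr rfl), phiStar_eq_zero_right]
    simp
  · rw [insert3_of_gt h hlt, pullback_pvar (sorted_three h0.1 h hlt hz.2),
      if_pos (h.trans hlt), if_pos hlt]
    ring

theorem pullback_Rrel {I : Fin 2 → ℕ} {J : Fin 4 → ℕ} (hI : Sorted 2 6 I) (hJ : Sorted 4 6 J) :
    pullback S (Rrel 6 I J) = 0 := by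
  have h01 := hJ.1 (show (0 : Fin 4) < 1 by decide)
  have h12 := hJ.1 (show (1 : Fin 4) < 2 by decide)
  have h23 := hJ.1 (show (2 : Fin 4) < 3 by decide)
  have h0 := hJ.2 0
  have h1 := hJ.2 1
  have h2 := hJ.2 2
  have h3 := hJ.2 3
  have key : ∀ a, pullback S ((-1) ^ ((Finset.univ.filter fun b : Fin 2 => I b < J a).card +
      (Finset.univ.filter fun b : Fin 4 => J a < J b).card) *
      (pvar 6 (insert3 I (J a)) * pvar 6 (erase4 J (J a)))) =
      (-1) ^ (Finset.univ.filter fun b : Fin 4 => a < b).card *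
        ((X (0, 0) * phiStar 6 S ![I 0, I 1, J a]) *
          (X (0, 0) * phiStar 6 S (erase4 J (J a)))) := by
    intro a
    have hs : Sorted 3 6 (erase4 J (J a)) := by
      fin_cases a
      · rw [Fin.zero_eta, erase4_zero]; exact sorted_three (by omega) h12 h23 (by omega)
      · rw [Fin.mk_one, erase4_one hJ.1]
        exact sorted_three (by omega) (h01.trans h12) h23 (by omega)
      · rw [show (⟨2, by omega⟩ : Fin 4) = 2 from rfl, erase4_two hJ.1]
        exact sorted_three (by omega) h01 (h12.trans h23) (by omega)
      · rw [show (⟨3, by omega⟩ : Fin 4) = 3 from rfl, erase4_three hJ.1]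
        exact sorted_three (by omega) h01 h12 (by omega)
    simp only [hJ.1.lt_iff_lt]
    rw [map_mul, map_mul, pullback_insert3 hI (hJ.2 a), pullback_pvar hs, map_pow, map_neg, map_one,
      pow_add]
    have hsq : ∀ k : ℕ, ((-1) ^ k * (-1) ^ k : MvPolynomial (ℕ × ℕ) ℂ) = 1 := by
      intro k; rw [← mul_pow]; simp
    linear_combination ((-1) ^ (Finset.univ.filter fun b : Fin 4 => a < b).card *
        ((X (0, 0) * phiStar 6 S ![I 0, I 1, J a]) * (X (0, 0) * phiStar 6 S (erase4 J (J a))))) *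
      hsq (Finset.univ.filter fun b : Fin 2 => I b < J a).card
  rw [Rrel, map_sum, Finset.sum_congr rfl fun a _ => key a, Fin.sum_univ_four, erase4_zero,
    erase4_one hJ.1, erase4_two hJ.1, erase4_three hJ.1,
    show (Finset.univ.filter fun b : Fin 4 => 0 < b).card = 3 by decide,
    show (Finset.univ.filter fun b : Fin 4 => 1 < b).card = 2 by decide,
    show (Finset.univ.filter fun b : Fin 4 => 2 < b).card = 1 by decide,
    show (Finset.univ.filter fun b : Fin 4 => 3 < b).card = 0 by decide]
  linear_combination (X (0, 0)) ^ 2 * phiStar_exchange S (I 0) (I 1) (J 0) (J 1) (J 2) (J 3)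

theorem pullback_eq_zero {f : PRing 6} (hf : f ∈ PluckerIdeal 6) : pullback S f = 0 := by
  have : PluckerIdeal 6 ≤ RingHom.ker (pullback S) := by
    refine Ideal.span_le.2 ?_
    rintro _ ⟨I, J, hI, hJ, rfl⟩
    exact pullback_Rrel hI hJ
  exact this hf

/-- The exponent of the lowest monomial of the pullback of a monomial. -/
noncomputable def leadExp (S : List (ℕ × ℕ)) (m : MI 6 →₀ ℕ) : (ℕ × ℕ) →₀ ℕ :=
  m.sum fun K c => c • (Finsupp.single (0, 0) 1 + valS 6 S K.1)

theorem leadExp_add (m m' : MI 6 →₀ ℕ) : leadExp S (m + m') = leadExp S m + leadExp S m' :=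
  Finsupp.sum_add_index' (by simp) (by intros; rw [add_smul])

theorem MSdot_add (m m' : MI 6 →₀ ℕ) : MSdot 6 S (m + m') = MSdot 6 S m + MSdot 6 S m' :=
  Finsupp.sum_add_index' (by simp) (by intros; rw [add_smul])

theorem leadExp_single (K : MI 6) :
    leadExp S (Finsupp.single K 1) = Finsupp.single (0, 0) 1 + valS 6 S K.1 := by
  simp [leadExp]

theorem MSdot_single (K : MI 6) : MSdot 6 S (Finsupp.single K 1) = valS 6 S K.1 := by
  simp [MSdot]

theorem leadExp_eq (m : MI 6 →₀ ℕ) :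
    leadExp S m = Finsupp.single (0, 0) (m.sum fun _ c => c) + MSdot 6 S m := by
  simp [leadExp, MSdot, Finsupp.sum, smul_add, Finset.sum_add_distrib, Finsupp.single_finsetSum]

theorem isLead_pullback_monomial {s : MI 6 → ℂ}
    (h : ∀ K : MI 6, IsLead S (phiStar 6 S K.1) (valS 6 S K.1) (s K)) (m : MI 6 →₀ ℕ) :
    IsLead S (pullback S (monomial m 1)) (leadExp S m) (m.prod fun K c => s K ^ c) := by
  induction m using Finsupp.induction_linear with
  | zero =>
    rw [monomial_zero', C_1, map_one]
    simpa [leadExp] using IsLead.monomial S 0 one_ne_zero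
  | add m m' hm hm' =>
    rw [show (monomial (m + m') (1 : ℂ)) = monomial m 1 * monomial m' 1 by simp [monomial_mul],
      map_mul, leadExp_add, Finsupp.prod_add_index' (by simp) (by intros; rw [pow_add])]
    exact hm.mul hm'
  | single K n =>
    induction n with
    | zero =>
      rw [Finsupp.single_zero, monomial_zero', C_1, map_one]
      simpa [leadExp] using IsLead.monomial S 0 one_ne_zero
    | succ n ih =>
      rw [Finsupp.single_add, show (monomial (Finsupp.single K n + Finsupp.single K 1) (1 : ℂ)) =
        monomial (Finsupp.single K n) 1 * monomial (Finsupp.single K 1) 1 by simp [monomial_mul],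
        map_mul, leadExp_add, Finsupp.prod_add_index' (by simp) (by intros; rw [pow_add])]
      refine ih.mul ?_
      rw [leadExp_single, Finsupp.prod_single_index (by simp), pow_one, ← X, pullback, aeval_X,
        ← one_mul (s K)]
      exact (IsLead.monomial S _ one_ne_zero).mul (h K)

end

/-- The toric degeneration of `pullback`: every Plücker coordinate goes to its lowest term. -/
noncomputable def leadMap (S : List (ℕ × ℕ)) (s : MI 6 → ℂ) :
    PRing 6 →ₐ[ℂ] MvPolynomial (ℕ × ℕ) ℂ :=
  aeval fun K : MI 6 => monomial (Finsupp.single (0, 0) 1 + valS 6 S K.1) (s K)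

theorem leadMap_monomial (S : List (ℕ × ℕ)) (s : MI 6 → ℂ) (m : MI 6 →₀ ℕ) (c : ℂ) :
    leadMap S s (monomial m c) = monomial (leadExp S m) (c * m.prod fun K e => s K ^ e) := by
  have hprod : ∀ t : Finset (MI 6), ∏ K ∈ t,
      (monomial (Finsupp.single (0, 0) 1 + valS 6 S K.1) (s K) : MvPolynomial (ℕ × ℕ) ℂ) ^ m K =
      monomial (∑ K ∈ t, m K • (Finsupp.single (0, 0) 1 + valS 6 S K.1)) (∏ K ∈ t, s K ^ m K) := by
    classical
    intro t
    induction t using Finset.induction_on with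
    | empty => simp
    | insert K t hK ih =>
      rw [Finset.prod_insert hK, Finset.prod_insert hK, Finset.sum_insert hK, ih,
        monomial_pow, monomial_mul]
  rw [leadMap, aeval_monomial, Finsupp.prod, hprod, algebraMap_eq, C_mul_monomial]
  rfl

section

variable {S : List (ℕ × ℕ)} (hS0 : ∀ k < S.length, S.getD k (0, 0) ≠ (0, 0))
  (hv0 : ∀ K : MI 6, valS 6 S K.1 (0, 0) = 0)

include hv0 in
theorem MSdot_apply_zero (m : MI 6 →₀ ℕ) : MSdot 6 S m (0, 0) = 0 := by
  simp [MSdot, Finsupp.sum, Finsupp.finsetSum_apply, hv0]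

include hv0 in
theorem MSdot_eq_of_leadExp_eq {m m' : MI 6 →₀ ℕ} (h : leadExp S m = leadExp S m') :
    MSdot 6 S m = MSdot 6 S m' := by
  rw [leadExp_eq, leadExp_eq] at h
  have h0 := congrArg (fun e => e (0, 0)) h
  simp [MSdot_apply_zero hv0] at h0
  rw [h0] at h
  exact add_left_cancel h

include hS0 in
theorem psiLT_of_leadExp {m m' : MI 6 →₀ ℕ} (h : psiLT S (leadExp S m) (leadExp S m')) :
    psiLT S (MSdot 6 S m) (MSdot 6 S m') := by
  have hP : ∀ m, Psi (leadExp S m) = Psi (MSdot 6 S m) := by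
    intro m
    rw [leadExp_eq, Psi_add, Psi_single]
    simp [Ht]
  have hc : ∀ m, ∀ k < S.length,
      leadExp S m (S.getD k (0, 0)) = MSdot 6 S m (S.getD k (0, 0)) := by
    intro m k hk
    rw [leadExp_eq, Finsupp.add_apply, Finsupp.single_eq_of_ne (hS0 k hk), zero_add]
  simp only [psiLT, hP] at h ⊢
  refine h.imp_right fun ⟨h1, k, hk, h2, h3⟩ => ⟨h1, k, hk, fun l hl => ?_, ?_⟩
  · rw [← hc _ l (hl.trans hk), ← hc _ l (hl.trans hk), h2 l hl]
  · rwa [← hc _ k hk, ← hc _ k hk]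

include hS0 hv0 in
theorem leadMap_inM {s : MI 6 → ℂ}
    (h : ∀ K : MI 6, IsLead S (phiStar 6 S K.1) (valS 6 S K.1) (s K)) {f : PRing 6}
    (hf : f ∈ PluckerIdeal 6) : leadMap S s (inM 6 S f) = 0 := by
  classical
  have hpull : ∀ D, ∑ m ∈ f.support, coeff m f * coeff D (pullback S (monomial m 1)) = 0 := by
    intro D
    have h0 := congrArg (coeff D) (pullback_eq_zero (S := S) hf)
    rw [f.as_sum, map_sum, coeff_sum, coeff_zero] at h0
    rw [← h0]
    refine Finset.sum_congr rfl fun m _ => ?_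
    rw [show monomial m (coeff m f) = coeff m f • monomial m (1 : ℂ) by simp [smul_monomial],
      map_smul, coeff_smul, smul_eq_mul]
  ext D
  rw [inM, map_sum, coeff_sum, coeff_zero]
  simp only [leadMap_monomial, coeff_monomial]
  by_cases hD : ∃ m₁ ∈ f.support, (∀ m' ∈ f.support, psiLE S (MSdot 6 S m₁) (MSdot 6 S m')) ∧
      leadExp S m₁ = D
  · obtain ⟨m₁, hm₁, hmin, rfl⟩ := hD
    refine Eq.trans ?_ (hpull (leadExp S m₁))
    rw [Finset.sum_filter]
    refine Finset.sum_congr rfl fun m hm => ?_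
    obtain ⟨-, hl1, hl2⟩ := isLead_pullback_monomial h m
    by_cases he : leadExp S m = leadExp S m₁
    · rw [if_pos, if_pos he, ← he, hl1]
      rw [MSdot_eq_of_leadExp_eq hv0 he]
      exact hmin
    · rw [if_neg he, ite_self]
      by_contra hne
      have hmem : leadExp S m₁ ∈ (pullback S (monomial m 1)).support :=
        mem_support_iff.2 (right_ne_zero_of_mul (Ne.symm hne))
      exact psiLT_not_psiLE (psiLT_of_leadExp hS0 (hl2 _ hmem (Ne.symm he))) (hmin m hm)
  · refine Finset.sum_eq_zero fun m hm => if_neg fun he => hD ?_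
    rw [Finset.mem_filter] at hm
    exact ⟨m, hm.1, hm.2, he⟩

include hS0 hv0 in
theorem InIdeal_le_ker {s : MI 6 → ℂ}
    (h : ∀ K : MI 6, IsLead S (phiStar 6 S K.1) (valS 6 S K.1) (s K)) :
    InIdeal 6 S ≤ RingHom.ker (leadMap S s) := by
  refine Ideal.span_le.2 ?_
  rintro _ ⟨f, hf, -, rfl⟩
  exact leadMap_inM hS0 hv0 h hf

end

/-- The ideal `G` contains a binomial whose terms are the products of the Plücker variables
in the multisets `M` and `M'`. -/
def BinomialIn (G : Ideal (PRing 6)) (M M' : Multiset (MI 6)) : Prop :=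
  ∃ ε : ℂ, ε ≠ 0 ∧ (M.map X).prod - C ε * (M'.map X).prod ∈ G

namespace BinomialIn

variable {G : Ideal (PRing 6)} {M M' M'' : Multiset (MI 6)}

theorem refl (G : Ideal (PRing 6)) (M : Multiset (MI 6)) : BinomialIn G M M :=
  ⟨1, one_ne_zero, by simp⟩

theorem symm (h : BinomialIn G M M') : BinomialIn G M' M := by
  obtain ⟨ε, h0, h⟩ := h
  refine ⟨ε⁻¹, inv_ne_zero h0, ?_⟩
  have hC : (C ε⁻¹ * C ε : PRing 6) = 1 := by rw [← C_mul, inv_mul_cancel₀ h0, C_1]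
  have := G.mul_mem_left (-C ε⁻¹) h
  convert this using 1
  linear_combination (-(M'.map X).prod) * hC

theorem trans (h : BinomialIn G M M') (h' : BinomialIn G M' M'') : BinomialIn G M M'' := by
  obtain ⟨ε, h0, h⟩ := h
  obtain ⟨ε', h0', h'⟩ := h'
  refine ⟨ε * ε', mul_ne_zero h0 h0', ?_⟩
  have := G.add_mem h (G.mul_mem_left (C ε) h')
  convert this using 1
  rw [C_mul]
  ring

theorem add_right (h : BinomialIn G M M') (N : Multiset (MI 6)) :
    BinomialIn G (M + N) (M' + N) := by
  obtain ⟨ε, h0, h⟩ := h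
  refine ⟨ε, h0, ?_⟩
  have := G.mul_mem_left (N.map X).prod h
  convert this using 1
  rw [Multiset.map_add, Multiset.map_add, Multiset.prod_add, Multiset.prod_add]
  ring

end BinomialIn

/-- If monomials with the same lowest term are related by binomials in `G`, then `G` contains
the kernel of `leadMap`. -/
theorem ker_leadMap_le {S : List (ℕ × ℕ)} {s : MI 6 → ℂ} (hs : ∀ K, s K ≠ 0)
    {G : Ideal (PRing 6)} (hG : G ≤ RingHom.ker (leadMap S s))
    (hE : ∀ m m' : MI 6 →₀ ℕ, leadExp S m = leadExp S m' →
      BinomialIn G m.toMultiset m'.toMultiset) :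
    RingHom.ker (leadMap S s) ≤ G := by
  classical
  have hprod : ∀ m : MI 6 →₀ ℕ, ((m.toMultiset).map X).prod = (monomial m 1 : PRing 6) := by
    intro m
    rw [Finsupp.toMultiset_map, Finsupp.prod_toMultiset, monomial_eq, C_1, one_mul,
      Finsupp.prod_mapDomain_index (by simp) (by intros; rw [pow_add])]
  intro f
  induction hn : f.support.card using Nat.strong_induction_on generalizing f with
  | _ n ih =>
  intro hf
  by_cases h0 : f = 0
  · rw [h0]; exact G.zero_mem
  obtain ⟨m₀, hm₀⟩ := support_nonempty.2 h0
  have hex : ∃ m₁ ∈ f.support, m₁ ≠ m₀ ∧ leadExp S m₀ = leadExp S m₁ := by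
    by_contra! hcon
    have hc := congrArg (coeff (leadExp S m₀)) (RingHom.mem_ker.1 hf)
    rw [f.as_sum, map_sum, coeff_sum, coeff_zero, Finset.sum_eq_single m₀] at hc
    · rw [leadMap_monomial, coeff_monomial, if_pos rfl] at hc
      refine mul_ne_zero (mem_support_iff.1 hm₀) ?_ hc
      exact Finset.prod_ne_zero_iff.2 fun K _ => pow_ne_zero _ (hs K)
    · intro m hm hne
      rw [leadMap_monomial, coeff_monomial, if_neg (hcon m hm hne).symm]
    · exact fun h => absurd hm₀ h
  obtain ⟨m₁, hm₁, hne, hl⟩ := hex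
  obtain ⟨ε, -, hε⟩ := hE m₀ m₁ hl
  rw [hprod, hprod] at hε
  set b : PRing 6 := C (coeff m₀ f) * (monomial m₀ 1 - C ε * monomial m₁ 1) with hb
  have hbG : b ∈ G := G.mul_mem_left _ hε
  have hb' : b = monomial m₀ (coeff m₀ f) - monomial m₁ (coeff m₀ f * ε) := by
    rw [hb, mul_sub, C_mul_monomial, ← mul_assoc, ← C_mul, C_mul_monomial, mul_one, mul_one]
  have hsub : (f - b).support ⊆ f.support.erase m₀ := by
    intro m hm
    rw [mem_support_iff, coeff_sub, hb', coeff_sub, coeff_monomial, coeff_monomial] at hm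
    rw [Finset.mem_erase]
    constructor
    · rintro rfl
      simp [hne] at hm
    · by_contra hmf
      have hm0 : m₀ ≠ m := by rintro rfl; exact hmf hm₀
      have hm1 : m₁ ≠ m := by rintro rfl; exact hmf hm₁
      rw [if_neg hm0, if_neg hm1, notMem_support_iff.1 hmf] at hm
      simp at hm
  have hlt : (f - b).support.card < n := by
    rw [← hn]
    exact (Finset.card_le_card hsub).trans_lt (Finset.card_erase_lt_of_mem hm₀)
  have := ih _ hlt rfl (Ideal.sub_mem _ hf (hG hbG))
  have := G.add_mem this hbG
  rwa [sub_add_cancel] at this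

theorem inM_eq_of_two_terms {S : List (ℕ × ℕ)} {m m' : MI 6 →₀ ℕ} {c c' : ℂ} {g : PRing 6}
    (hc : c ≠ 0) (hc' : c' ≠ 0) (hne : m ≠ m') (hM : MSdot 6 S m = MSdot 6 S m')
    (hg : ∀ e ∈ g.support, psiLT S (MSdot 6 S m) (MSdot 6 S e)) :
    monomial m c + monomial m' c' + g ≠ 0 ∧
      inM 6 S (monomial m c + monomial m' c' + g) = monomial m c + monomial m' c' := by
  classical
  have hgm : coeff m g = 0 := by
    by_contra h
    exact psiLT_irrefl S _ (hg m (mem_support_iff.2 h))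
  have hgm' : coeff m' g = 0 := by
    by_contra h
    exact psiLT_irrefl S _ (hM ▸ hg m' (mem_support_iff.2 h))
  have h1 : coeff m (monomial m c + monomial m' c' + g) = c := by
    simp [coeff_monomial, hgm, hne.symm]
  have h2 : coeff m' (monomial m c + monomial m' c' + g) = c' := by
    simp [coeff_monomial, hgm', hne]
  generalize hf : monomial m c + monomial m' c' + g = f at *
  have hsupp : ∀ e ∈ f.support, e = m ∨ e = m' ∨ e ∈ g.support := by
    intro e he
    by_contra! hcon
    rw [mem_support_iff, ← hf] at he
    simp [coeff_monomial, hcon.1.symm, hcon.2.1.symm, notMem_support_iff.1 hcon.2.2] at he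
  have hfilter : (f.support.filter fun e => ∀ e' ∈ f.support,
      psiLE S (MSdot 6 S e) (MSdot 6 S e')) = {m, m'} := by
    ext e
    rw [Finset.mem_filter, Finset.mem_insert, Finset.mem_singleton]
    constructor
    · rintro ⟨he, hmin⟩
      rcases hsupp e he with h | h | h
      · exact Or.inl h
      · exact Or.inr h
      · exact absurd (hmin m (mem_support_iff.2 (by rwa [h1]))) (psiLT_not_psiLE (hg e h))
    · intro he
      have hm : MSdot 6 S e = MSdot 6 S m := by
        rcases he with rfl | rfl
        · rfl
        · exact hM.symm
      refine ⟨?_, fun e' he' => ?_⟩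
      · rcases he with rfl | rfl
        · rw [mem_support_iff, h1]; exact hc
        · rw [mem_support_iff, h2]; exact hc'
      · rw [hm]
        rcases hsupp e' he' with rfl | rfl | h
        · exact psiLE_refl _ _
        · rw [hM]; exact psiLE_refl _ _
        · exact (hg e' h).le
  refine ⟨fun h0 => hc (by rw [← h1, h0, coeff_zero]), ?_⟩
  rw [inM]
  rw [Finset.sum_congr (s₂ := {m, m'}) (by convert hfilter) fun _ _ => rfl, Finset.sum_pair hne,
    h1, h2]

/-- The ideal generated by the initial forms of the nonzero Plücker relations. -/
noncomputable def initialRelIdeal (S : List (ℕ × ℕ)) : Ideal (PRing 6) :=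
  Ideal.span {g | ∃ I J, Sorted 2 6 I ∧ Sorted 4 6 J ∧ Rrel 6 I J ≠ 0 ∧
    g = inM 6 S (Rrel 6 I J)}

theorem X_mul_X (K K' : MI 6) :
    (X K * X K' : PRing 6) = monomial (Finsupp.single K 1 + Finsupp.single K' 1) 1 := by
  rw [X, X, monomial_mul, one_mul]

theorem binomialIn_of_exchange {S : List (ℕ × ℕ)} {K₁ K₂ K₃ K₄ : MI 6} {x y : ℕ}
    (hx : x ∈ cols K₂) (hx' : x ∉ cols K₁) (hy : y ∈ cols K₁) (hy' : y ∉ cols K₂)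
    (h₃ : cols K₃ = insert x ((cols K₁).erase y)) (h₄ : cols K₄ = insert y ((cols K₂).erase x))
    (hval : valS 6 S K₁.1 + valS 6 S K₂.1 = valS 6 S K₃.1 + valS 6 S K₄.1)
    (hbig : ∀ z ∈ cols K₁, z ∉ cols K₂ → z ≠ y → ∀ K₅ K₆ : MI 6,
      cols K₅ = insert z ((cols K₂).erase x) → cols K₆ = insert x ((cols K₁).erase z) →
      psiLT S (valS 6 S K₁.1 + valS 6 S K₂.1) (valS 6 S K₅.1 + valS 6 S K₆.1)) :
    BinomialIn (initialRelIdeal S) {K₁, K₂} {K₃, K₄} := by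
  classical
  have hxy : x ≠ y := by rintro rfl; exact hx' hy
  have hI6 : (cols K₂).erase x ⊆ Finset.Icc 1 6 := (Finset.erase_subset _ _).trans (cols_subset K₂)
  have hJ6 : insert x (cols K₁) ⊆ Finset.Icc 1 6 :=
    Finset.insert_subset (cols_subset K₂ hx) (cols_subset K₁)
  obtain ⟨I, J, ε, hI, hJ, hε, hR⟩ := exists_Rrel_eq (I := (cols K₂).erase x)
    (J := insert x (cols K₁)) (by rw [Finset.card_erase_of_mem hx, card_cols])
    (by rw [Finset.card_insert_of_notMem hx', card_cols]) hI6 hJ6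
  have hxm : x ∈ insert x (cols K₁) \ (cols K₂).erase x := by simp
  have hym : y ∈ (insert x (cols K₁) \ (cols K₂).erase x).erase x := by
    simp [hxy.symm, hy, hy']
  rw [← Finset.add_sum_erase _ _ hxm, ← Finset.add_sum_erase _ _ hym, Finset.insert_erase hx,
    Finset.erase_insert hx', ← h₄, Finset.erase_insert_of_ne hxy, ← h₃, pset_cols, pset_cols,
    pset_cols, pset_cols, X_mul_X, X_mul_X, C_mul_monomial, C_mul_monomial, mul_one, mul_one,
    ← add_assoc] at hR
  by_cases hne : Finsupp.single K₂ 1 + Finsupp.single K₁ 1 =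
      Finsupp.single K₄ 1 + Finsupp.single K₃ (1 : ℕ)
  · have h := congrArg Finsupp.toMultiset hne
    simp only [map_add, Finsupp.toMultiset_single, one_smul, Multiset.singleton_add] at h
    have h' : ({K₁, K₂} : Multiset (MI 6)) = {K₃, K₄} := by
      rw [Multiset.pair_comm, Multiset.pair_comm K₃]; exact h
    rw [h']
    exact BinomialIn.refl _ _
  have hMS : ∀ K K' : MI 6, MSdot 6 S (Finsupp.single K 1 + Finsupp.single K' 1) =
      valS 6 S K.1 + valS 6 S K'.1 := by
    intro K K'
    rw [MSdot_add, MSdot_single, MSdot_single]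
  obtain ⟨h0, hin⟩ := inM_eq_of_two_terms (S := S) (hε x) (hε y) hne
    (g := ∑ z ∈ ((insert x (cols K₁) \ (cols K₂).erase x).erase x).erase y,
      C (ε z) * (pset (insert z ((cols K₂).erase x)) * pset ((insert x (cols K₁)).erase z)))
    (by rw [hMS, hMS, add_comm, hval, add_comm]) (by
      intro e he
      obtain ⟨z, hz, hez⟩ := Finset.mem_biUnion.1 (support_sum he)
      simp only [Finset.mem_erase, Finset.mem_sdiff, Finset.mem_insert, not_and] at hz
      obtain ⟨hzy, hzx, hz1, hz2⟩ := hz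
      have hz1 := hz1.resolve_left hzx
      have hz2 := hz2 hzx
      obtain ⟨K₅, hK₅⟩ := exists_cols_eq (F := insert z ((cols K₂).erase x)) (by
        rw [Finset.card_insert_of_notMem (by simp [hz2]), Finset.card_erase_of_mem hx, card_cols])
        (Finset.insert_subset (cols_subset K₁ hz1) hI6)
      obtain ⟨K₆, hK₆⟩ := exists_cols_eq (F := (insert x (cols K₁)).erase z) (by
        rw [Finset.card_erase_of_mem (by simp [hz1]), Finset.card_insert_of_notMem hx', card_cols])
        ((Finset.erase_subset _ _).trans hJ6)
      rw [← hK₅, ← hK₆, pset_cols, pset_cols, X_mul_X, C_mul_monomial] at hez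
      have he' := Finset.mem_singleton.1 (support_monomial_subset hez)
      rw [he', hMS, hMS, add_comm]
      exact hbig z hz1 hz2 hzy K₅ K₆ hK₅ (by rw [hK₆, Finset.erase_insert_of_ne (Ne.symm hzx)]))
  rw [← hR] at h0 hin
  have hmem : inM 6 S (Rrel 6 I J) ∈ initialRelIdeal S :=
    Ideal.subset_span ⟨I, J, hI, hJ, h0, rfl⟩
  refine ⟨-(ε x)⁻¹ * ε y, mul_ne_zero (neg_ne_zero.2 (inv_ne_zero (hε x))) (hε y), ?_⟩
  have := (initialRelIdeal S).mul_mem_left (C (ε x)⁻¹) hmem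
  rw [hin, mul_add, C_mul_monomial, C_mul_monomial, inv_mul_cancel₀ (hε x)] at this
  convert this using 1
  have hpair : ∀ K K' : MI 6,
      ((({K, K'} : Multiset (MI 6)).map X).prod : PRing 6) = X K * X K' := by
    intro K K'; simp
  rw [hpair, hpair, mul_comm (X K₁), mul_comm (X K₃), X_mul_X, X_mul_X, C_mul_monomial, mul_one,
    neg_mul, map_neg, sub_neg_eq_add]

theorem binomialIn_of_exchange_compl {S : List (ℕ × ℕ)} {i j : ℕ → ℕ} {r q p : MI 6 → ℕ}
    (hV : ValData i j r q p) {K₁ K₂ K₃ K₄ : MI 6} {x y : ℕ}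
    (hx : x ∈ [r K₁, q K₁, p K₁]) (hx' : x ∉ [r K₂, q K₂, p K₂])
    (hy : y ∈ [r K₂, q K₂, p K₂]) (hy' : y ∉ [r K₁, q K₁, p K₁])
    (h₃ : ∀ z, z ∈ [r K₃, q K₃, p K₃] ↔ z = y ∨ (z ≠ x ∧ z ∈ [r K₁, q K₁, p K₁]))
    (h₄ : ∀ z, z ∈ [r K₄, q K₄, p K₄] ↔ z = x ∨ (z ≠ y ∧ z ∈ [r K₂, q K₂, p K₂]))
    (hval : valS 6 S K₁.1 + valS 6 S K₂.1 = valS 6 S K₃.1 + valS 6 S K₄.1)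
    (hbig : ∀ z ∈ [r K₂, q K₂, p K₂], z ∉ [r K₁, q K₁, p K₁] → z ≠ y → ∀ K₅ K₆ : MI 6,
      (∀ w, w ∈ [r K₅, q K₅, p K₅] ↔ w = x ∨ (w ≠ z ∧ w ∈ [r K₂, q K₂, p K₂])) →
      (∀ w, w ∈ [r K₆, q K₆, p K₆] ↔ w = z ∨ (w ≠ x ∧ w ∈ [r K₁, q K₁, p K₁])) →
      psiLT S (valS 6 S K₁.1 + valS 6 S K₂.1) (valS 6 S K₅.1 + valS 6 S K₆.1)) :
    BinomialIn (initialRelIdeal S) {K₁, K₂} {K₃, K₄} := by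
  have hc : ∀ K z, z ∈ [r K, q K, p K] ↔ z ∈ Finset.Icc 1 6 ∧ z ∉ cols K := by
    intro K z
    rw [← List.mem_toFinset, hV.compl, Finset.mem_sdiff]
  have hs : ∀ K z, z ∈ cols K → z ∈ Finset.Icc 1 6 := fun K z h => cols_subset K h
  simp only [hc] at *
  refine binomialIn_of_exchange (x := x) (y := y) (by grind) (by grind) (by grind) (by grind)
    ?_ ?_ hval ?_
  · ext z
    simp only [Finset.mem_insert, Finset.mem_erase]
    have := h₃ z
    grind
  · ext z
    simp only [Finset.mem_insert, Finset.mem_erase]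
    have := h₄ z
    grind
  · intro z hz hz' hzy K₅ K₆ h₅ h₆
    refine hbig z ?_ ?_ hzy K₅ K₆ ?_ ?_
    · grind
    · grind
    · intro w
      rw [h₅]
      simp only [Finset.mem_insert, Finset.mem_erase]
      grind
    · intro w
      rw [h₆]
      simp only [Finset.mem_insert, Finset.mem_erase]
      grind

theorem unitExp_apply_of_ne {x y n m : ℕ} (h : n ≠ m) : unitExp x n (y, m) = 0 := by
  unfold unitExp
  split_ifs
  · rfl
  · rw [Finsupp.single_apply, if_neg (by simp [h])]

theorem unitExp_apply {x y n : ℕ} (h : y ≠ n) : unitExp x n (y, n) = if x = y then 1 else 0 := by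
  unfold unitExp
  by_cases hx : x = n
  · rw [if_pos hx, if_neg (by omega)]
    rfl
  · rw [if_neg hx, Finsupp.single_apply]
    simp

theorem wt_apply_six {r q p x : ℕ} (h : x ≠ 6) : wt r q p (x, 6) = if r = x then 1 else 0 := by
  simp [wt, unitExp_apply h, unitExp_apply_of_ne]

theorem wt_apply_five {r q p x : ℕ} (h : x ≠ 5) : wt r q p (x, 5) = if q = x then 1 else 0 := by
  simp [wt, unitExp_apply h, unitExp_apply_of_ne]

theorem wt_apply_four {r q p x : ℕ} (h : x ≠ 4) : wt r q p (x, 4) = if p = x then 1 else 0 := by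
  simp [wt, unitExp_apply h, unitExp_apply_of_ne]

theorem wt_apply_zero (r q p : ℕ) : wt r q p (0, 0) = 0 := by
  simp [wt, unitExp_apply_of_ne]

theorem Psi_unitExp {x n : ℕ} (h : x ≤ n) : Psi (unitExp x n) + x = n := by
  unfold unitExp
  split_ifs with hx
  · simp [Psi, hx]
  · rw [Psi_single]
    simp [Ht]
    omega

theorem perm_of_mem_iff {l l' : List ℕ} (h : l.Nodup) (h' : l'.Nodup)
    (hm : ∀ w, w ∈ l ↔ w ∈ l') : l.Perm l' :=
  (List.perm_ext_iff_of_nodup h h').2 hm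

namespace IterData

variable {S : List (ℕ × ℕ)} {i j : ℕ → ℕ} {L : List (ℕ × ℕ)} (hS : IterData S i j L)
include hS

theorem q_le_five {r q p : ℕ} (h : Valid i j r q p) : q ≤ 5 := by
  have h1 := hS.depth_i_six
  have h2 := h.q_mem
  have h3 := h.r_lt_q
  have h4 : q ≠ 6 := by rintro rfl; omega
  omega

theorem p_le_four {r q p : ℕ} (h : Valid i j r q p) : p ≤ 4 := by
  have h1 := hS.depth_i_six
  have h2 := hS.depth_j_five
  have h3 := h.p_mem
  have h4 := h.r_lt_p
  have h5 := h.q_lt_p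
  have h6 : p ≠ 6 := by rintro rfl; omega
  have h7 : p ≠ 5 := by rintro rfl; omega
  omega

theorem Psi_wt {r q p : ℕ} (h : Valid i j r q p) : Psi (wt r q p) + [r, q, p].sum = 15 := by
  have h1 := Psi_unitExp h.r_mem.2
  have h2 := Psi_unitExp (hS.q_le_five h)
  have h3 := Psi_unitExp (hS.p_le_four h)
  simp only [wt, Psi_add, List.sum_cons, List.sum_nil]
  omega

theorem getD_six {k : ℕ} (hk : k < 3) : S.getD k (0, 0) = (i (k + 1), 6) := by
  rw [hS.eq]
  interval_cases k <;> rfl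

theorem getD_five {k : ℕ} (hk : k < 3) : S.getD (3 + k) (0, 0) = (j (k + 1), 5) := by
  rw [hS.eq]
  interval_cases k <;> rfl

theorem lt_length {k : ℕ} (hk : k < 6) : k < S.length := by
  rw [hS.eq]
  simp
  omega

theorem i_ne_six {k : ℕ} (hk : k < 3) : i (k + 1) ≠ 6 := by
  have := hS.i_mem (k + 1) (by omega) (by omega)
  omega

theorem j_ne_five {k : ℕ} (hk : k < 3) : j (k + 1) ≠ 5 := by
  have := hS.j_mem (k + 1) (by omega) (by omega)
  omega

theorem psiLT_of_r {r₁ q₁ p₁ r₂ q₂ p₂ r₅ q₅ p₅ r₆ q₆ p₆ : ℕ} (h₁ : Valid i j r₁ q₁ p₁)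
    (h₂ : Valid i j r₂ q₂ p₂) (h₅ : Valid i j r₅ q₅ p₅) (h₆ : Valid i j r₆ q₆ p₆)
    (hsum : [r₁, q₁, p₁].sum + [r₂, q₂, p₂].sum = [r₅, q₅, p₅].sum + [r₆, q₆, p₆].sum)
    (hr : r₅ = r₁) (hlt : depth i r₂ < depth i r₆) (hpos : 1 ≤ depth i r₂) :
    psiLT S (wt r₁ q₁ p₁ + wt r₂ q₂ p₂) (wt r₅ q₅ p₅ + wt r₆ q₆ p₆) := by
  have e1 := hS.Psi_wt h₁
  have e2 := hS.Psi_wt h₂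
  have e5 := hS.Psi_wt h₅
  have e6 := hS.Psi_wt h₆
  subst hr
  have h4 : depth i r₂ < 4 := by have := h₂.r_lt_q; have := depth_le i q₂; omega
  have hd : ∀ k ≤ 3, depth i (i k) = k := fun k hk => depth_apply hS.i_inj hk
  refine Or.inr ⟨by simp only [Psi_add]; omega, depth i r₂ - 1, hS.lt_length (by omega), ?_, ?_⟩
  · intro m hm
    have hm' := hd (m + 1) (by omega)
    rw [hS.getD_six (by omega), Finsupp.add_apply, Finsupp.add_apply]
    simp only [wt_apply_six (hS.i_ne_six (show m < 3 by omega))]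
    rw [if_neg (show r₆ ≠ _ by rintro rfl; omega), if_neg (show r₂ ≠ _ by rintro rfl; omega)]
  · have hm' := hd (depth i r₂ - 1 + 1) (by omega)
    rw [hS.getD_six (by omega), Finsupp.add_apply, Finsupp.add_apply]
    simp only [wt_apply_six (hS.i_ne_six (show depth i r₂ - 1 < 3 by omega))]
    rw [if_neg (show r₆ ≠ _ by rintro h; rw [← h] at hm'; omega),
      if_pos (show r₂ = _ by rw [Nat.sub_add_cancel hpos, apply_depth h4])]
    omega

theorem psiLT_of_q {r₁ q₁ p₁ r₂ q₂ p₂ r₅ q₅ p₅ r₆ q₆ p₆ : ℕ} (h₁ : Valid i j r₁ q₁ p₁)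
    (h₂ : Valid i j r₂ q₂ p₂) (h₅ : Valid i j r₅ q₅ p₅) (h₆ : Valid i j r₆ q₆ p₆)
    (hsum : [r₁, q₁, p₁].sum + [r₂, q₂, p₂].sum = [r₅, q₅, p₅].sum + [r₆, q₆, p₆].sum)
    (hr : r₅ = r₁ ∧ r₆ = r₂ ∨ r₅ = r₂ ∧ r₆ = r₁) (hq : q₅ = q₁)
    (hlt : depth j q₂ < depth j q₆) (hpos : 1 ≤ depth j q₂) :
    psiLT S (wt r₁ q₁ p₁ + wt r₂ q₂ p₂) (wt r₅ q₅ p₅ + wt r₆ q₆ p₆) := by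
  have e1 := hS.Psi_wt h₁
  have e2 := hS.Psi_wt h₂
  have e5 := hS.Psi_wt h₅
  have e6 := hS.Psi_wt h₆
  subst hq
  have hr6 : ∀ x, x ≠ 6 → wt r₅ q₅ p₅ (x, 6) + wt r₆ q₆ p₆ (x, 6) =
      wt r₁ q₅ p₁ (x, 6) + wt r₂ q₂ p₂ (x, 6) := by
    intro x hx
    simp only [wt_apply_six hx]
    rcases hr with ⟨rfl, rfl⟩ | ⟨rfl, rfl⟩
    · rfl
    · exact add_comm _ _
  have h4 : depth j q₂ < 4 := by have := h₂.q_lt_p; have := depth_le j p₂; omega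
  have hd : ∀ k ≤ 3, depth j (j k) = k := fun k hk => depth_apply hS.j_inj hk
  refine Or.inr ⟨by simp only [Psi_add]; omega, 3 + (depth j q₂ - 1),
    hS.lt_length (by omega), ?_, ?_⟩
  · intro m hm
    by_cases hm3 : m < 3
    · rw [hS.getD_six hm3, Finsupp.add_apply, Finsupp.add_apply,
        hr6 _ (hS.i_ne_six hm3)]
    · obtain ⟨m, rfl⟩ := Nat.exists_eq_add_of_le (not_lt.1 hm3)
      have hm' := hd (m + 1) (by omega)
      rw [hS.getD_five (by omega), Finsupp.add_apply, Finsupp.add_apply]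
      simp only [wt_apply_five (hS.j_ne_five (show m < 3 by omega))]
      rw [if_neg (show q₆ ≠ _ by rintro rfl; omega), if_neg (show q₂ ≠ _ by rintro rfl; omega)]
  · have hm' := hd (depth j q₂ - 1 + 1) (by omega)
    rw [hS.getD_five (by omega), Finsupp.add_apply, Finsupp.add_apply]
    simp only [wt_apply_five (hS.j_ne_five (show depth j q₂ - 1 < 3 by omega))]
    rw [if_neg (show q₆ ≠ _ by rintro h; rw [← h] at hm'; omega),
      if_pos (show q₂ = _ by rw [Nat.sub_add_cancel hpos, apply_depth h4])]
    omega

section Swap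

variable {r q p : MI 6 → ℕ} (hV : ValData i j r q p) {K₁ K₂ K₃ K₄ : MI 6}
include hV

theorem valS_swap (hr : ({r K₁, r K₂} : Multiset ℕ) = {r K₃, r K₄})
    (hq : ({q K₁, q K₂} : Multiset ℕ) = {q K₃, q K₄})
    (hp : ({p K₁, p K₂} : Multiset ℕ) = {p K₃, p K₄}) :
    valS 6 S K₁.1 + valS 6 S K₂.1 = valS 6 S K₃.1 + valS 6 S K₄.1 := by
  have h : ∀ (f : MI 6 → ℕ) n, ({f K₁, f K₂} : Multiset ℕ) = {f K₃, f K₄} →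
      unitExp (f K₁) n + unitExp (f K₂) n = unitExp (f K₃) n + unitExp (f K₄) n := by
    intro f n hf
    simpa using congrArg (fun s => (s.map (unitExp · n)).sum) hf
  simp only [(hS.exists_isLead_valS hV).1, wt]
  rw [add_add_add_comm, add_add_add_comm (unitExp (q K₁) 5), h r 6 hr, h q 5 hq, h p 4 hp]
  abel

theorem binomialIn_swap_r_of_lt (hr₃ : r K₃ = r K₂) (hq₃ : q K₃ = q K₁) (hp₃ : p K₃ = p K₁)
    (hr₄ : r K₄ = r K₁) (hq₄ : q K₄ = q K₂) (hp₄ : p K₄ = p K₂)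
    (hlt : depth i (r K₁) < depth i (r K₂)) :
    BinomialIn (initialRelIdeal S) {K₁, K₂} {K₃, K₄} := by
  have v1 := hV.valid K₁
  have v2 := hV.valid K₂
  have v3 := hV.valid K₃
  have v4 := hV.valid K₄
  have hval : valS 6 S K₁.1 + valS 6 S K₂.1 = valS 6 S K₃.1 + valS 6 S K₄.1 :=
    hS.valS_swap hV (by rw [hr₃, hr₄, Multiset.pair_comm]) (by rw [hq₃, hq₄])
      (by rw [hp₃, hp₄])
  rw [hr₃, hq₃, hp₃] at v3
  rw [hr₄, hq₄, hp₄] at v4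
  have n1 := v1.nodup
  have n2 := v2.nodup
  have n3 := v3.nodup
  have n4 := v4.nodup
  have hne : r K₁ ≠ r K₂ := fun h => by rw [h] at hlt; omega
  simp at n1 n2 n3 n4
  refine binomialIn_of_exchange_compl hV (x := r K₁) (y := r K₂) (by simp) (by simp; grind)
    (by simp) (by simp; grind) (by intro z; simp [hr₃, hq₃, hp₃]; grind)
    (by intro z; simp [hr₄, hq₄, hp₄]; grind) hval ?_
  intro z hz hz1 hzy K₅ K₆ h₅ h₆
  have v5 := hV.valid K₅
  have v6 := hV.valid K₆
  simp only [(hS.exists_isLead_valS hV).1]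
  simp at hz hz1
  have p6 : [r K₆, q K₆, p K₆].Perm [q K₁, p K₁, z] :=
    perm_of_mem_iff v6.nodup (by simp; grind) (by intro w; rw [h₆]; simp; grind)
  have s6 := p6.sum_eq
  rcases hz with rfl | rfl | rfl
  · exact absurd rfl hzy
  · have p5 : [r K₅, q K₅, p K₅].Perm [r K₁, r K₂, p K₂] :=
      perm_of_mem_iff v5.nodup (by simp; grind) (by intro w; rw [h₅]; simp; grind)
    have s5 := p5.sum_eq
    refine hS.psiLT_of_r v1 v2 v5 v6 (by simp at s5 s6 ⊢; omega)
      (v5.r_eq p5 hlt v4.r_lt_p).1 (lt_depth_of_perm p6 v3.r_lt_q v3.r_lt_p v2.r_lt_q) (by omega)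
  · have p5 : [r K₅, q K₅, p K₅].Perm [r K₁, r K₂, q K₂] :=
      perm_of_mem_iff v5.nodup (by simp; grind) (by intro w; rw [h₅]; simp; grind)
    have s5 := p5.sum_eq
    refine hS.psiLT_of_r v1 v2 v5 v6 (by simp at s5 s6 ⊢; omega)
      (v5.r_eq p5 hlt v4.r_lt_q).1 (lt_depth_of_perm p6 v3.r_lt_q v3.r_lt_p v2.r_lt_p) (by omega)

theorem binomialIn_swap_r (hr₃ : r K₃ = r K₂) (hq₃ : q K₃ = q K₁) (hp₃ : p K₃ = p K₁)
    (hr₄ : r K₄ = r K₁) (hq₄ : q K₄ = q K₂) (hp₄ : p K₄ = p K₂) :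
    BinomialIn (initialRelIdeal S) {K₁, K₂} {K₃, K₄} := by
  rcases lt_trichotomy (depth i (r K₁)) (depth i (r K₂)) with h | h | h
  · exact hS.binomialIn_swap_r_of_lt hV hr₃ hq₃ hp₃ hr₄ hq₄ hp₄ h
  · have h4 := depth_le i (q K₁)
    have h5 := (hV.valid K₁).r_lt_q
    have h6 := depth_inj (by omega) h
    rw [hV.inj (hr₃.trans h6.symm) hq₃ hp₃, hV.inj (hr₄.trans h6) hq₄ hp₄]
    exact BinomialIn.refl _ _
  · rw [Multiset.pair_comm K₁, Multiset.pair_comm K₃]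
    exact hS.binomialIn_swap_r_of_lt hV hr₄ hq₄ hp₄ hr₃ hq₃ hp₃ h

theorem binomialIn_swap_q_of_le (hr₃ : r K₃ = r K₁) (hq₃ : q K₃ = q K₂) (hp₃ : p K₃ = p K₁)
    (hr₄ : r K₄ = r K₂) (hq₄ : q K₄ = q K₁) (hp₄ : p K₄ = p K₂)
    (hle : depth i (r K₁) ≤ depth i (r K₂)) :
    BinomialIn (initialRelIdeal S) {K₁, K₂} {K₃, K₄} := by
  have v1 := hV.valid K₁
  have v2 := hV.valid K₂
  have v3 := hV.valid K₃
  have v4 := hV.valid K₄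
  have hval : valS 6 S K₁.1 + valS 6 S K₂.1 = valS 6 S K₃.1 + valS 6 S K₄.1 :=
    hS.valS_swap hV (by rw [hr₃, hr₄]) (by rw [hq₃, hq₄, Multiset.pair_comm]) (by rw [hp₃, hp₄])
  by_cases hne : q K₁ = q K₂
  · rw [hV.inj hr₃ (hq₃.trans hne.symm) hp₃, hV.inj hr₄ (hq₄.trans hne) hp₄]
    exact BinomialIn.refl _ _
  have hdne := hS.depth_j_ne hne ⟨v1.q_mem.1, hS.q_le_five v1⟩ ⟨v2.q_mem.1, hS.q_le_five v2⟩
  rw [hr₃, hq₃, hp₃] at v3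
  rw [hr₄, hq₄, hp₄] at v4
  have n1 := v1.nodup
  have n2 := v2.nodup
  have n3 := v3.nodup
  have n4 := v4.nodup
  simp at n1 n2 n3 n4
  refine binomialIn_of_exchange_compl hV (x := q K₁) (y := q K₂) (by simp) (by simp; grind)
    (by simp) (by simp; grind) (by intro z; simp [hr₃, hq₃, hp₃]; grind)
    (by intro z; simp [hr₄, hq₄, hp₄]; grind) hval ?_
  intro z hz hz1 hzy K₅ K₆ h₅ h₆
  have v5 := hV.valid K₅
  have v6 := hV.valid K₆
  simp only [(hS.exists_isLead_valS hV).1]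
  simp at hz hz1
  have p6 : [r K₆, q K₆, p K₆].Perm [r K₁, p K₁, z] :=
    perm_of_mem_iff v6.nodup (by simp; grind) (by intro w; rw [h₆]; simp; grind)
  have s6 := p6.sum_eq
  rcases hz with rfl | rfl | rfl
  · have hlt : depth i (r K₁) < depth i (r K₂) := by
      have h4 := depth_le i (q K₁)
      have h5 := v1.r_lt_q
      exact lt_of_le_of_ne hle fun h => hz1.1 (depth_inj (by omega) h).symm
    have p5 : [r K₅, q K₅, p K₅].Perm [q K₁, q K₂, p K₂] :=
      perm_of_mem_iff v5.nodup (by simp; grind) (by intro w; rw [h₅]; simp; grind)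
    have s5 := p5.sum_eq
    rw [add_comm (wt (r K₅) _ _)]
    exact hS.psiLT_of_r v1 v2 v6 v5 (by simp at s5 s6 ⊢; omega)
      (v6.r_eq p6 v1.r_lt_p hlt).1 (lt_depth_of_perm p5 v4.r_lt_q v2.r_lt_q v2.r_lt_p) (by omega)
  · exact absurd rfl hzy
  · have p5 : [r K₅, q K₅, p K₅].Perm [r K₂, q K₁, q K₂] :=
      perm_of_mem_iff v5.nodup (by simp; grind) (by intro w; rw [h₅]; simp; grind)
    have s5 := p5.sum_eq
    have r5 := v5.r_eq p5 v4.r_lt_q v2.r_lt_q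
    have r6 := v6.r_eq p6 v1.r_lt_p (hle.trans_lt v2.r_lt_p)
    have hq6 : ∀ k, k < depth j (p K₁) → k < depth j (p K₂) → k < depth j (q K₆) := by
      intro k h1 h2
      have : q K₆ ∈ [p K₁, p K₂] := r6.2.mem_iff.1 (by simp)
      simp at this
      rcases this with h | h <;> rw [h] <;> assumption
    rcases lt_or_gt_of_ne hdne with h | h
    · exact hS.psiLT_of_q v1 v2 v5 v6 (by simp at s5 s6 ⊢; omega) (Or.inr ⟨r5.1, r6.1⟩)
        (v5.q_eq r5.2 h).1 (hq6 _ v3.q_lt_p v2.q_lt_p) (by omega)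
    · rw [add_comm (wt (r K₁) _ _)]
      exact hS.psiLT_of_q v2 v1 v5 v6 (by simp at s5 s6 ⊢; omega) (Or.inl ⟨r5.1, r6.1⟩)
        (v5.q_eq (r5.2.trans (List.Perm.swap _ _ _)) h).1 (hq6 _ v1.q_lt_p v4.q_lt_p) (by omega)

theorem binomialIn_swap_q (hr₃ : r K₃ = r K₁) (hq₃ : q K₃ = q K₂) (hp₃ : p K₃ = p K₁)
    (hr₄ : r K₄ = r K₂) (hq₄ : q K₄ = q K₁) (hp₄ : p K₄ = p K₂) :
    BinomialIn (initialRelIdeal S) {K₁, K₂} {K₃, K₄} := by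
  rcases le_total (depth i (r K₁)) (depth i (r K₂)) with h | h
  · exact hS.binomialIn_swap_q_of_le hV hr₃ hq₃ hp₃ hr₄ hq₄ hp₄ h
  · rw [Multiset.pair_comm K₁, Multiset.pair_comm K₃]
    exact hS.binomialIn_swap_q_of_le hV hr₄ hq₄ hp₄ hr₃ hq₃ hp₃ h

theorem binomialIn_swap_p_of_le (hr₃ : r K₃ = r K₁) (hq₃ : q K₃ = q K₁) (hp₃ : p K₃ = p K₂)
    (hr₄ : r K₄ = r K₂) (hq₄ : q K₄ = q K₂) (hp₄ : p K₄ = p K₁)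
    (hle : depth i (r K₁) ≤ depth i (r K₂)) :
    BinomialIn (initialRelIdeal S) {K₁, K₂} {K₃, K₄} := by
  have v1 := hV.valid K₁
  have v2 := hV.valid K₂
  have v3 := hV.valid K₃
  have v4 := hV.valid K₄
  have hval : valS 6 S K₁.1 + valS 6 S K₂.1 = valS 6 S K₃.1 + valS 6 S K₄.1 :=
    hS.valS_swap hV (by rw [hr₃, hr₄]) (by rw [hq₃, hq₄]) (by rw [hp₃, hp₄, Multiset.pair_comm])
  by_cases hne : p K₁ = p K₂
  · rw [hV.inj hr₃ hq₃ (hp₃.trans hne.symm), hV.inj hr₄ hq₄ (hp₄.trans hne)]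
    exact BinomialIn.refl _ _
  rw [hr₃, hq₃, hp₃] at v3
  rw [hr₄, hq₄, hp₄] at v4
  have n1 := v1.nodup
  have n2 := v2.nodup
  have n3 := v3.nodup
  have n4 := v4.nodup
  simp at n1 n2 n3 n4
  refine binomialIn_of_exchange_compl hV (x := p K₁) (y := p K₂) (by simp) (by simp; grind)
    (by simp) (by simp; grind) (by intro z; simp [hr₃, hq₃, hp₃]; grind)
    (by intro z; simp [hr₄, hq₄, hp₄]; grind) hval ?_
  intro z hz hz1 hzy K₅ K₆ h₅ h₆
  have v5 := hV.valid K₅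
  have v6 := hV.valid K₆
  simp only [(hS.exists_isLead_valS hV).1]
  simp at hz hz1
  have p6 : [r K₆, q K₆, p K₆].Perm [r K₁, q K₁, z] :=
    perm_of_mem_iff v6.nodup (by simp; grind) (by intro w; rw [h₆]; simp; grind)
  have s6 := p6.sum_eq
  rw [add_comm (wt (r K₅) _ _)]
  rcases hz with rfl | rfl | rfl
  · have hlt : depth i (r K₁) < depth i (r K₂) := by
      have h4 := depth_le i (q K₁)
      have h5 := v1.r_lt_q
      exact lt_of_le_of_ne hle fun h => hz1.1 (depth_inj (by omega) h).symm
    have p5 : [r K₅, q K₅, p K₅].Perm [q K₂, p K₁, p K₂] :=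
      perm_of_mem_iff v5.nodup (by simp; grind) (by intro w; rw [h₅]; simp; grind)
    have s5 := p5.sum_eq
    exact hS.psiLT_of_r v1 v2 v6 v5 (by simp at s5 s6 ⊢; omega)
      (v6.r_eq p6 v1.r_lt_q hlt).1 (lt_depth_of_perm p5 v2.r_lt_q v4.r_lt_p v2.r_lt_p) (by omega)
  · have p5 : [r K₅, q K₅, p K₅].Perm [r K₂, p K₁, p K₂] :=
      perm_of_mem_iff v5.nodup (by simp; grind) (by intro w; rw [h₅]; simp; grind)
    have s5 := p5.sum_eq
    have r5 := v5.r_eq p5 v4.r_lt_p v2.r_lt_p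
    have r6 := v6.r_eq p6 v1.r_lt_q (hle.trans_lt v2.r_lt_q)
    have hq5 : ∀ k, k < depth j (p K₁) → k < depth j (p K₂) → k < depth j (q K₅) := by
      intro k h1 h2
      have : q K₅ ∈ [p K₁, p K₂] := r5.2.mem_iff.1 (by simp)
      simp at this
      rcases this with h | h <;> rw [h] <;> assumption
    have hdne := hS.depth_j_ne (Ne.symm hz1.2.1) ⟨v1.q_mem.1, hS.q_le_five v1⟩
      ⟨v2.q_mem.1, hS.q_le_five v2⟩
    rcases lt_or_gt_of_ne hdne with h | h
    · exact hS.psiLT_of_q v1 v2 v6 v5 (by simp at s5 s6 ⊢; omega) (Or.inl ⟨r6.1, r5.1⟩)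
        (v6.q_eq r6.2 h).1 (hq5 _ v4.q_lt_p v2.q_lt_p) (by omega)
    · rw [add_comm (wt (r K₁) _ _)]
      exact hS.psiLT_of_q v2 v1 v6 v5 (by simp at s5 s6 ⊢; omega) (Or.inr ⟨r6.1, r5.1⟩)
        (v6.q_eq (r6.2.trans (List.Perm.swap _ _ _)) h).1 (hq5 _ v1.q_lt_p v3.q_lt_p) (by omega)
  · exact absurd rfl hzy

theorem binomialIn_swap_p (hr₃ : r K₃ = r K₁) (hq₃ : q K₃ = q K₁) (hp₃ : p K₃ = p K₂)
    (hr₄ : r K₄ = r K₂) (hq₄ : q K₄ = q K₂) (hp₄ : p K₄ = p K₁) :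
    BinomialIn (initialRelIdeal S) {K₁, K₂} {K₃, K₄} := by
  rcases le_total (depth i (r K₁)) (depth i (r K₂)) with h | h
  · exact hS.binomialIn_swap_p_of_le hV hr₃ hq₃ hp₃ hr₄ hq₄ hp₄ h
  · rw [Multiset.pair_comm K₁, Multiset.pair_comm K₃]
    exact hS.binomialIn_swap_p_of_le hV hr₄ hq₄ hp₄ hr₃ hq₃ hp₃ h

end Swap

end IterData

/-- `M` and `M'` are related by a binomial of the initial ideal of the Plücker relations, and the
multisets of first, second and third entries of their elements agree. -/
structure Linked (S : List (ℕ × ℕ)) (r q p : MI 6 → ℕ) (M M' : Multiset (MI 6)) : Prop where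
  binomialIn : BinomialIn (initialRelIdeal S) M M'
  map_r : M.map r = M'.map r
  map_q : M.map q = M'.map q
  map_p : M.map p = M'.map p

namespace Linked

variable {S : List (ℕ × ℕ)} {r q p : MI 6 → ℕ} {M M' M'' : Multiset (MI 6)}

theorem refl (S : List (ℕ × ℕ)) (r q p : MI 6 → ℕ) (M : Multiset (MI 6)) : Linked S r q p M M :=
  ⟨BinomialIn.refl _ _, rfl, rfl, rfl⟩

theorem trans (h : Linked S r q p M M') (h' : Linked S r q p M' M'') : Linked S r q p M M'' :=
  ⟨h.1.trans h'.1, h.2.trans h'.2, h.3.trans h'.3, h.4.trans h'.4⟩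

end Linked

theorem exists_mem_of_map_eq {f : MI 6 → ℕ} {M M' : Multiset (MI 6)} (h : M.map f = M'.map f)
    {K : MI 6} (hK : K ∈ M) : ∃ K' ∈ M', f K' = f K :=
  Multiset.mem_map.1 (h ▸ Multiset.mem_map_of_mem f hK)

theorem exists_linked {S : List (ℕ × ℕ)} {r q p : MI 6 → ℕ} {M : Multiset (MI 6)}
    {K₁ K₂ K₃ K₄ : MI 6} (h : Linked S r q p {K₁, K₂} {K₃, K₄})
    (heq : K₁ = K₂ → K₃ = K₁ ∧ K₄ = K₁) (h₁ : K₁ ∈ M) (h₂ : K₂ ∈ M) :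
    ∃ M', Linked S r q p M M' ∧ K₃ ∈ M' ∧ K₄ ∈ M' ∧ ∀ K ∈ M, K ≠ K₁ → K ≠ K₂ → K ∈ M' := by
  by_cases hne : K₁ = K₂
  · obtain ⟨rfl, rfl⟩ := heq hne
    exact ⟨M, Linked.refl _ _ _ _ _, h₁, h₁, fun K hK _ _ => hK⟩
  · obtain ⟨N, rfl⟩ := Multiset.exists_cons_of_mem h₁
    obtain ⟨N, rfl⟩ := Multiset.exists_cons_of_mem
      ((Multiset.mem_cons.1 h₂).resolve_left (Ne.symm hne))
    have hN : K₁ ::ₘ K₂ ::ₘ N = {K₁, K₂} + N := by simp [Multiset.insert_eq_cons]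
    rw [hN]
    have hL : Linked S r q p ({K₁, K₂} + N) ({K₃, K₄} + N) := by
      constructor
      · exact h.1.add_right N
      · rw [Multiset.map_add, h.2, Multiset.map_add]
      · rw [Multiset.map_add, h.3, Multiset.map_add]
      · rw [Multiset.map_add, h.4, Multiset.map_add]
    have hmem : ∀ {A B K : MI 6}, K ∈ ({A, B} : Multiset (MI 6)) + N ↔ K = A ∨ K = B ∨ K ∈ N := by
      intro A B K
      rw [Multiset.mem_add, Multiset.insert_eq_cons, Multiset.mem_cons, Multiset.mem_singleton,
        or_assoc]
    refine Exists.intro _ (And.intro hL (And.intro ?_ (And.intro ?_ ?_)))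
    · exact hmem.2 (Or.inl rfl)
    · exact hmem.2 (Or.inr (Or.inl rfl))
    · intro K hK h1 h2
      exact hmem.2 (Or.inr (Or.inr (((hmem.1 hK).resolve_left h1).resolve_left h2)))

theorem exists_mem_forall_le {M : Multiset (MI 6)} (hM : M ≠ 0) (f : MI 6 → ℕ) :
    ∃ K ∈ M, ∀ K' ∈ M, f K' ≤ f K := by
  classical
  obtain ⟨K, hK⟩ := Multiset.exists_mem_of_ne_zero hM
  obtain ⟨K, hK, h⟩ := M.toFinset.exists_max_image f ⟨K, Multiset.mem_toFinset.2 hK⟩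
  exact ⟨K, Multiset.mem_toFinset.1 hK, fun K' hK' => h K' (Multiset.mem_toFinset.2 hK')⟩

/-- Some element of `M` has both its second and third entries of maximal depth. -/
def HasTop (j : ℕ → ℕ) (q p : MI 6 → ℕ) (M : Multiset (MI 6)) : Prop :=
  ∃ K ∈ M, ∀ K' ∈ M, depth j (q K') ≤ depth j (q K) ∧ depth j (p K') ≤ depth j (p K)

namespace ValData

variable {i j : ℕ → ℕ} {r q p : MI 6 → ℕ} (hV : ValData i j r q p)
include hV

theorem depth_i_q_ne_p (K : MI 6) (h : depth i (q K) < 4 ∨ depth i (p K) < 4) :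
    depth i (q K) ≠ depth i (p K) := by
  refine depth_ne (fun he => ?_) h
  have := (hV.valid K).q_lt_p
  rw [he] at this
  omega

theorem eq_of_depth_one_two {K₁ K₂ : MI 6} (h₁ : depth i (r K₁) = 0) (h₂ : depth i (r K₂) = 0)
    (h₁' : depth i (q K₁) = 1 ∧ depth i (p K₁) = 2 ∨ depth i (q K₁) = 2 ∧ depth i (p K₁) = 1)
    (h₂' : depth i (q K₂) = 1 ∧ depth i (p K₂) = 2 ∨ depth i (q K₂) = 2 ∧ depth i (p K₂) = 1) :
    K₁ = K₂ := by
  have v1 := (hV.valid K₁).q_lt_p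
  have v2 := (hV.valid K₂).q_lt_p
  have hinj : ∀ x y, depth i x < 4 → depth i x = depth i y → x = y := fun x y => depth_inj
  have hr := hinj _ _ (by omega) (h₁.trans h₂.symm)
  have key : q K₁ = q K₂ ∧ p K₁ = p K₂ := by
    by_cases h : depth i (q K₁) = depth i (q K₂)
    · exact ⟨hinj _ _ (by omega) h, hinj _ _ (by omega) (by omega)⟩
    · have hqp := hinj (q K₁) (p K₂) (by omega) (by omega)
      have hpq := hinj (p K₁) (q K₂) (by omega) (by omega)
      rw [hqp, hpq] at v1
      omega
  exact hV.inj hr key.1 key.2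

theorem mem_of_forall_depth_le {M M' : Multiset (MI 6)} {K₁ : MI 6} (hr : M.map r = M'.map r)
    (hq : M.map q = M'.map q) (hp : M.map p = M'.map p)
    (h3 : ∀ K ∈ M, depth i (r K) ≠ 3) (hK : K₁ ∈ M) (h₁ : depth i (r K₁) = 0)
    (h₁' : depth i (q K₁) = 1 ∧ depth i (p K₁) = 2 ∨ depth i (q K₁) = 2 ∧ depth i (p K₁) = 1)
    (hM : ∀ K ∈ M, depth i (r K) < 2 → depth i (q K) ≤ 2 ∨ depth i (p K) ≤ 2) : K₁ ∈ M' := by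
  by_contra hK'
  let a : ℕ → ℕ := fun x => if depth i x = 2 then 1 else 0
  let b : ℕ → ℕ := fun x => if depth i x = 1 ∨ depth i x = 2 then 1 else 0
  let F : MI 6 → ℕ := fun K => a (r K) + (b (q K) + b (p K))
  have hF : ∀ N : Multiset (MI 6), (N.map F).sum =
      ((N.map r).map a).sum + (((N.map q).map b).sum + ((N.map p).map b).sum) := by
    intro N
    simp [F, Multiset.sum_map_add]
  have hsum : (M.map F).sum = (M'.map F).sum := by rw [hF, hF, hr, hq, hp]
  have hcard : M.card = M'.card := by simpa using congrArg Multiset.card hr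
  have hlow : M.card + 1 ≤ (M.map F).sum := by
    obtain ⟨N, rfl⟩ := Multiset.exists_cons_of_mem hK
    have hN : (N.map fun _ => 1).sum ≤ (N.map F).sum := by
      refine Multiset.sum_map_le_sum_map _ _ fun K hK => ?_
      have h1 := (hV.valid K).r_lt_q
      have h2 := (hV.valid K).r_lt_p
      have h4 := h3 K (Multiset.mem_cons_of_mem hK)
      have h5 := hM K (Multiset.mem_cons_of_mem hK)
      have h6 := depth_le i (q K)
      simp only [F, a, b]
      split_ifs <;> omega
    have h1 : F K₁ = 2 := by
      simp only [F, a, b]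
      rw [if_neg (by omega), if_pos (by omega), if_pos (by omega)]
    simp [h1] at hN ⊢
    omega
  have hup : (M'.map F).sum ≤ (M'.map fun _ => 1).sum := by
    refine Multiset.sum_map_le_sum_map _ _ fun K hK => ?_
    have h1 := (hV.valid K).r_lt_q
    have h2 := (hV.valid K).r_lt_p
    have h4 := hV.depth_i_q_ne_p K
    have h5 : depth i (r K) = 0 → ¬ (depth i (q K) = 1 ∧ depth i (p K) = 2 ∨
        depth i (q K) = 2 ∧ depth i (p K) = 1) := fun h h' =>
      hK' (hV.eq_of_depth_one_two h₁ h h₁' h' ▸ hK)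
    simp only [F, a, b]
    split_ifs <;> omega
  simp at hup
  omega

end ValData

namespace IterData

variable {S : List (ℕ × ℕ)} {i j : ℕ → ℕ} {L : List (ℕ × ℕ)} (hS : IterData S i j L)
  {r q p : MI 6 → ℕ} (hV : ValData i j r q p) {M M' : Multiset (MI 6)} {K₁ K₂ : MI 6}
include hS hV

theorem exists_linked_swap_r (h₁ : K₁ ∈ M) (h₂ : K₂ ∈ M) (v₃ : Valid i j (r K₂) (q K₁) (p K₁))
    (v₄ : Valid i j (r K₁) (q K₂) (p K₂)) :
    ∃ M', Linked S r q p M M' ∧ (∃ K ∈ M', r K = r K₂ ∧ q K = q K₁ ∧ p K = p K₁) ∧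
      (∃ K ∈ M', r K = r K₁ ∧ q K = q K₂ ∧ p K = p K₂) ∧
      ∀ K ∈ M, K ≠ K₁ → K ≠ K₂ → K ∈ M' := by
  obtain ⟨K₃, hr₃, hq₃, hp₃⟩ := hV.surj v₃
  obtain ⟨K₄, hr₄, hq₄, hp₄⟩ := hV.surj v₄
  obtain ⟨M', h, h3, h4, hM⟩ := exists_linked (r := r) (q := q) (p := p) (K₃ := K₃) (K₄ := K₄)
    ⟨hS.binomialIn_swap_r hV hr₃ hq₃ hp₃ hr₄ hq₄ hp₄, by
      simpa [hr₃, hr₄] using Multiset.pair_comm _ _,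
      by simp [hq₃, hq₄], by simp [hp₃, hp₄]⟩
    (by rintro rfl; exact ⟨hV.inj hr₃ hq₃ hp₃, hV.inj hr₄ hq₄ hp₄⟩) h₁ h₂
  exact ⟨M', h, ⟨K₃, h3, hr₃, hq₃, hp₃⟩, ⟨K₄, h4, hr₄, hq₄, hp₄⟩, hM⟩

theorem exists_linked_swap_q (h₁ : K₁ ∈ M) (h₂ : K₂ ∈ M) (v₃ : Valid i j (r K₁) (q K₂) (p K₁))
    (v₄ : Valid i j (r K₂) (q K₁) (p K₂)) :
    ∃ M', Linked S r q p M M' ∧ ∃ K ∈ M', q K = q K₂ ∧ p K = p K₁ := by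
  obtain ⟨K₃, hr₃, hq₃, hp₃⟩ := hV.surj v₃
  obtain ⟨K₄, hr₄, hq₄, hp₄⟩ := hV.surj v₄
  obtain ⟨M', h, h3, -, -⟩ := exists_linked (r := r) (q := q) (p := p) (K₃ := K₃) (K₄ := K₄)
    ⟨hS.binomialIn_swap_q hV hr₃ hq₃ hp₃ hr₄ hq₄ hp₄, by simp [hr₃, hr₄],
      by simpa [hq₃, hq₄] using Multiset.pair_comm _ _, by simp [hp₃, hp₄]⟩
    (by rintro rfl; exact ⟨hV.inj hr₃ hq₃ hp₃, hV.inj hr₄ hq₄ hp₄⟩) h₁ h₂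
  exact ⟨M', h, K₃, h3, hq₃, hp₃⟩

theorem exists_linked_swap_p (h₁ : K₁ ∈ M) (h₂ : K₂ ∈ M) (v₃ : Valid i j (r K₁) (q K₁) (p K₂))
    (v₄ : Valid i j (r K₂) (q K₂) (p K₁)) :
    ∃ M', Linked S r q p M M' ∧ ∃ K ∈ M', q K = q K₂ ∧ p K = p K₁ := by
  obtain ⟨K₃, hr₃, hq₃, hp₃⟩ := hV.surj v₃
  obtain ⟨K₄, hr₄, hq₄, hp₄⟩ := hV.surj v₄
  obtain ⟨M', h, -, h4, -⟩ := exists_linked (r := r) (q := q) (p := p) (K₃ := K₃) (K₄ := K₄)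
    ⟨hS.binomialIn_swap_p hV hr₃ hq₃ hp₃ hr₄ hq₄ hp₄, by simp [hr₃, hr₄],
      by simp [hq₃, hq₄], by simpa [hp₃, hp₄] using Multiset.pair_comm _ _⟩
    (by rintro rfl; exact ⟨hV.inj hr₃ hq₃ hp₃, hV.inj hr₄ hq₄ hp₄⟩) h₁ h₂
  exact ⟨M', h, K₄, h4, hq₄, hp₄⟩

theorem exists_linked_hasTop (h₁ : K₁ ∈ M) (h₂ : K₂ ∈ M)
    (hp : ∀ K ∈ M, depth j (p K) ≤ depth j (p K₁)) (hq : ∀ K ∈ M, depth j (q K) ≤ depth j (q K₂))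
    (h : depth i (r K₂) < depth i (q K₁) ∧ depth i (r K₁) < depth i (q K₂) ∨
      depth i (r K₁) < depth i (p K₂) ∧ depth i (r K₂) < depth i (p K₁)) :
    ∃ M', Linked S r q p M M' ∧ HasTop j q p M' := by
  have v1 := hV.valid K₁
  have v2 := hV.valid K₂
  have hp2 := hp K₂ h₂
  have hq1 := hq K₁ h₁
  have h12 := v1.q_lt_p
  have h22 := v2.q_lt_p
  have key : ∃ M', Linked S r q p M M' ∧ ∃ K ∈ M', q K = q K₂ ∧ p K = p K₁ := by
    rcases h with ⟨ha, hb⟩ | ⟨ha, hb⟩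
    · exact hS.exists_linked_swap_q hV h₁ h₂
        ⟨v1.r_mem, v2.q_mem, v1.p_mem, hb, v1.r_lt_p, by omega⟩
        ⟨v2.r_mem, v1.q_mem, v2.p_mem, ha, v2.r_lt_p, by omega⟩
    · exact hS.exists_linked_swap_p hV h₁ h₂
        ⟨v1.r_mem, v1.q_mem, v2.p_mem, v1.r_lt_q, ha, by omega⟩
        ⟨v2.r_mem, v2.q_mem, v1.p_mem, v2.r_lt_q, hb, by omega⟩
  obtain ⟨M', hM, K, hK, hKq, hKp⟩ := key
  refine ⟨M', hM, K, hK, fun K' hK' => ⟨?_, ?_⟩⟩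
  · obtain ⟨K'', h, h'⟩ := exists_mem_of_map_eq hM.map_q.symm hK'
    rw [← h', hKq]
    exact hq K'' h
  · obtain ⟨K'', h, h'⟩ := exists_mem_of_map_eq hM.map_p.symm hK'
    rw [← h', hKp]
    exact hp K'' h

/-- Two linked families with a top element have, after further moves, a common element. -/
theorem exists_common_of_hasTop (hr : M.map r = M'.map r) (hq : M.map q = M'.map q)
    (hp : M.map p = M'.map p) (h : HasTop j q p M) (h' : HasTop j q p M') :
    ∃ N N', Linked S r q p M N ∧ Linked S r q p M' N' ∧ ∃ K, K ∈ N ∧ K ∈ N' := by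
  obtain ⟨K, hK, hmax⟩ := h
  obtain ⟨K', hK', hmax'⟩ := h'
  have v := hV.valid K
  have v' := hV.valid K'
  have eq : q K = q K' := by
    obtain ⟨A, hA, hA'⟩ := exists_mem_of_map_eq hq hK
    obtain ⟨B, hB, hB'⟩ := exists_mem_of_map_eq hq.symm hK'
    have h1 := (hmax' A hA).1
    have h2 := (hmax B hB).1
    rw [hA'] at h1
    rw [hB'] at h2
    by_contra hne
    exact hS.depth_j_ne hne ⟨v.q_mem.1, hS.q_le_five v⟩ ⟨v'.q_mem.1, hS.q_le_five v'⟩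
      (le_antisymm h1 h2)
  have ep : p K = p K' := by
    obtain ⟨A, hA, hA'⟩ := exists_mem_of_map_eq hp hK
    obtain ⟨B, hB, hB'⟩ := exists_mem_of_map_eq hp.symm hK'
    have h1 := (hmax' A hA).2
    have h2 := (hmax B hB).2
    rw [hA'] at h1
    rw [hB'] at h2
    have h3 := hS.p_le_four v
    have h4 := hS.p_le_four v'
    by_contra hne
    exact hS.depth_j_ne hne ⟨v.p_mem.1, by omega⟩ ⟨v'.p_mem.1, by omega⟩ (le_antisymm h1 h2)
  rcases le_total (depth i (r K)) (depth i (r K')) with hle | hle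
  · obtain ⟨A, hA, hA'⟩ := exists_mem_of_map_eq hr.symm hK'
    have vA := hV.valid A
    obtain ⟨N, hN, ⟨B, hB, hBr, hBq, hBp⟩, -, -⟩ := hS.exists_linked_swap_r hV hK hA
      (by rw [hA', eq, ep]; exact v')
      ⟨v.r_mem, vA.q_mem, vA.p_mem, hle.trans_lt (hA' ▸ vA.r_lt_q), hle.trans_lt (hA' ▸ vA.r_lt_p),
        vA.q_lt_p⟩
    refine ⟨N, M', hN, Linked.refl _ _ _ _ _, K', ?_, hK'⟩
    rwa [← hV.inj (hBr.trans hA') (hBq.trans eq) (hBp.trans ep)]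
  · obtain ⟨A, hA, hA'⟩ := exists_mem_of_map_eq hr hK
    have vA := hV.valid A
    obtain ⟨N, hN, ⟨B, hB, hBr, hBq, hBp⟩, -, -⟩ := hS.exists_linked_swap_r hV hK' hA
      (by rw [hA', ← eq, ← ep]; exact v)
      ⟨v'.r_mem, vA.q_mem, vA.p_mem, hle.trans_lt (hA' ▸ vA.r_lt_q),
        hle.trans_lt (hA' ▸ vA.r_lt_p), vA.q_lt_p⟩
    refine ⟨M, N, Linked.refl _ _ _ _ _, hN, K, hK, ?_⟩
    rwa [← hV.inj (hBr.trans hA') (hBq.trans eq.symm) (hBp.trans ep.symm)]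

theorem eq_of_depth_eq_three (hK : depth i (r K₁) = 3) (h : r K₂ = r K₁) : K₂ = K₁ := by
  have v1 := hV.valid K₁
  have v2 := hV.valid K₂
  have n1 := v1.nodup
  have n2 := v2.nodup
  have h1 := v1.r_lt_q
  have h2 := v1.r_lt_p
  have h3 := v2.r_lt_q
  have h4 := v2.r_lt_p
  rw [h] at h3 h4
  simp at n1 n2
  have key : ∀ x, 1 ≤ x ∧ x ≤ 6 → depth i (r K₁) < depth i x → x = q K₁ ∨ x = p K₁ := by
    intro x hx hd
    by_contra! hcon
    have := hS.exists_depth_i_lt v1.q_mem v1.p_mem hx (by simp; grind)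
    omega
  have hperm : [q K₂, p K₂].Perm [q K₁, p K₁] :=
    perm_of_mem_iff (by simpa using n2.2) (by simpa using n1.2) (by
      have := key _ v2.q_mem h3
      have := key _ v2.p_mem h4
      intro w; simp; grind)
  obtain ⟨hq, hp⟩ := v2.q_eq hperm v1.q_lt_p
  exact hV.inj h hq hp

theorem hasTop_or_mem (hr : M.map r = M'.map r) (hq : M.map q = M'.map q)
    (hp : M.map p = M'.map p) (h0 : M ≠ 0) (h3 : ∀ K ∈ M, depth i (r K) ≠ 3) :
    (∃ N, Linked S r q p M N ∧ HasTop j q p N) ∨ ∃ K, K ∈ M ∧ K ∈ M' := by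
  obtain ⟨K₁, hK₁, hmp⟩ := exists_mem_forall_le h0 fun K => depth j (p K)
  obtain ⟨K₂, hK₂, hmq⟩ := exists_mem_forall_le h0 fun K => depth j (q K)
  have v1 := hV.valid K₁
  have v2 := hV.valid K₂
  have a1 := v1.r_lt_q
  have a2 := v1.r_lt_p
  have b1 := v2.r_lt_q
  have b2 := v2.r_lt_p
  have hd := depth_le i (q K₁)
  have hd' := depth_le i (q K₂)
  have d1 := hV.depth_i_q_ne_p K₁
  have d2 := hV.depth_i_q_ne_p K₂
  have l1 := h3 K₁ hK₁
  have l2 := h3 K₂ hK₂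
  by_cases hgood : depth i (r K₂) < depth i (q K₁) ∧ depth i (r K₁) < depth i (q K₂) ∨
      depth i (r K₁) < depth i (p K₂) ∧ depth i (r K₂) < depth i (p K₁)
  · exact Or.inl (hS.exists_linked_hasTop hV hK₁ hK₂ hmp hmq hgood)
  by_cases hg : ∃ K ∈ M, depth i (r K) < 2 ∧ 2 < depth i (q K) ∧ 2 < depth i (p K)
  swap
  · right
    push Not at hg
    rcases le_total (depth i (r K₁)) (depth i (r K₂)) with hle | hle
    · exact ⟨K₁, hK₁, hV.mem_of_forall_depth_le hr hq hp h3 hK₁ (by omega) (by omega)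
        fun K hK h => by have := hg K hK h; omega⟩
    · exact ⟨K₂, hK₂, hV.mem_of_forall_depth_le hr hq hp h3 hK₂ (by omega) (by omega)
        fun K hK h => by have := hg K hK h; omega⟩
  · left
    obtain ⟨K, hK, hKr, hKq, hKp⟩ := hg
    have v := hV.valid K
    have tr : ∀ N, Linked S r q p M N → (∃ N', Linked S r q p N N' ∧ HasTop j q p N') →
        ∃ N, Linked S r q p M N ∧ HasTop j q p N := by
      rintro N hN ⟨N', h, h'⟩
      exact ⟨N', hN.trans h, h'⟩
    have tp : ∀ N, Linked S r q p M N → ∀ A ∈ N, depth j (p A) ≤ depth j (p K₁) := by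
      intro N hN A hA
      obtain ⟨B, hB, hB'⟩ := exists_mem_of_map_eq hN.map_p.symm hA
      exact hB' ▸ hmp B hB
    have tq : ∀ N, Linked S r q p M N → ∀ A ∈ N, depth j (q A) ≤ depth j (q K₂) := by
      intro N hN A hA
      obtain ⟨B, hB, hB'⟩ := exists_mem_of_map_eq hN.map_q.symm hA
      exact hB' ▸ hmq B hB
    rcases le_total (depth i (r K₁)) (depth i (r K₂)) with hle | hle
    · obtain ⟨N, hN, ⟨A, hA, hAr, hAq, hAp⟩, -, hrest⟩ := hS.exists_linked_swap_r hV hK₂ hK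
        ⟨v.r_mem, v2.q_mem, v2.p_mem, by omega, by omega, v2.q_lt_p⟩
        ⟨v2.r_mem, v.q_mem, v.p_mem, by omega, by omega, v.q_lt_p⟩
      have hK₁' := hrest K₁ hK₁ (by rintro rfl; omega) (by rintro rfl; omega)
      refine tr N hN (hS.exists_linked_hasTop hV hK₁' hA (tp N hN) ?_ ?_)
      · rw [hAq]; exact tq N hN
      · rw [hAr, hAq, hAp]; omega
    · obtain ⟨N, hN, ⟨A, hA, hAr, hAq, hAp⟩, -, hrest⟩ := hS.exists_linked_swap_r hV hK₁ hK
        ⟨v.r_mem, v1.q_mem, v1.p_mem, by omega, by omega, v1.q_lt_p⟩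
        ⟨v1.r_mem, v.q_mem, v.p_mem, by omega, by omega, v.q_lt_p⟩
      have hK₂' := hrest K₂ hK₂ (by rintro rfl; omega) (by rintro rfl; omega)
      refine tr N hN (hS.exists_linked_hasTop hV hA hK₂' ?_ (tq N hN) ?_)
      · rw [hAp]; exact tp N hN
      · rw [hAr, hAq, hAp]; omega

theorem exists_common (hr : M.map r = M'.map r) (hq : M.map q = M'.map q)
    (hp : M.map p = M'.map p) (h0 : M ≠ 0) :
    ∃ N N', Linked S r q p M N ∧ Linked S r q p M' N' ∧ ∃ K, K ∈ N ∧ K ∈ N' := by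
  by_cases h3 : ∃ K ∈ M, depth i (r K) = 3
  · obtain ⟨K, hK, h⟩ := h3
    obtain ⟨K', hK', h'⟩ := exists_mem_of_map_eq hr hK
    exact ⟨M, M', Linked.refl _ _ _ _ _, Linked.refl _ _ _ _ _, K, hK,
      hS.eq_of_depth_eq_three hV h h' ▸ hK'⟩
  push Not at h3
  have h3' : ∀ K ∈ M', depth i (r K) ≠ 3 := by
    intro K hK
    obtain ⟨K', hK', h⟩ := exists_mem_of_map_eq hr.symm hK
    exact h ▸ h3 K' hK'
  have h0' : M' ≠ 0 := by
    rintro rfl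
    exact h0 (by simpa using hr)
  rcases hS.hasTop_or_mem hV hr hq hp h0 h3 with ⟨N, hN, hT⟩ | h
  swap
  · exact ⟨M, M', Linked.refl _ _ _ _ _, Linked.refl _ _ _ _ _, h⟩
  rcases hS.hasTop_or_mem hV hr.symm hq.symm hp.symm h0' h3' with ⟨N', hN', hT'⟩ | ⟨K, hK, hK'⟩
  swap
  · exact ⟨M, M', Linked.refl _ _ _ _ _, Linked.refl _ _ _ _ _, K, hK', hK⟩
  obtain ⟨P, P', hP, hP', h⟩ := hS.exists_common_of_hasTop hV
    (hN.map_r.symm.trans (hr.trans hN'.map_r)) (hN.map_q.symm.trans (hq.trans hN'.map_q))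
    (hN.map_p.symm.trans (hp.trans hN'.map_p)) hT hT'
  exact ⟨P, P', hN.trans hP, hN'.trans hP', h⟩

theorem binomialIn_of_map_eq (hr : M.map r = M'.map r) (hq : M.map q = M'.map q)
    (hp : M.map p = M'.map p) : BinomialIn (initialRelIdeal S) M M' := by
  induction hn : M.card generalizing M M' with
  | zero =>
    rw [Multiset.card_eq_zero] at hn
    subst hn
    have : M' = 0 := by simpa using hr.symm
    rw [this]
    exact BinomialIn.refl _ _
  | succ n ih =>
    obtain ⟨N, N', hN, hN', K, hK, hK'⟩ := hS.exists_common hV hr hq hp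
      (by rintro rfl; simp at hn)
    obtain ⟨P, rfl⟩ := Multiset.exists_cons_of_mem hK
    obtain ⟨P', rfl⟩ := Multiset.exists_cons_of_mem hK'
    have hr' := hN.map_r.symm.trans (hr.trans hN'.map_r)
    have hq' := hN.map_q.symm.trans (hq.trans hN'.map_q)
    have hp' := hN.map_p.symm.trans (hp.trans hN'.map_p)
    simp only [Multiset.map_cons, Multiset.cons_inj_right] at hr' hq' hp'
    have hc := congrArg Multiset.card hN.map_r
    simp at hc
    have := (ih hr' hq' hp' (by omega)).add_right {K}
    rw [add_comm, Multiset.singleton_add, add_comm, Multiset.singleton_add] at this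
    exact hN.binomialIn.trans (this.trans hN'.binomialIn.symm)

end IterData

theorem multiset_eq_of_count_eq {A B : Multiset ℕ} (n : ℕ) (hc : A.card = B.card)
    (h : ∀ x, x ≠ n → A.count x = B.count x) : A = B := by
  have hf : A.filter (· ≠ n) = B.filter (· ≠ n) := by
    ext x
    by_cases hx : x = n
    · simp [hx]
    · simp [hx, h x hx]
  ext x
  by_cases hx : x = n
  · subst hx
    have hA := congrArg Multiset.card (Multiset.filter_add_not (· ≠ x) A)
    have hB := congrArg Multiset.card (Multiset.filter_add_not (· ≠ x) B)
    rw [Multiset.card_add, hf] at hA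
    rw [Multiset.card_add] at hB
    have hx : ∀ C : Multiset ℕ, (C.filter fun y => ¬ y ≠ x).card = C.count x := by
      intro C
      rw [Multiset.count_eq_card_filter_eq]
      simp only [not_not, eq_comm]
    rw [hx] at hA hB
    omega
  · exact h x hx

theorem count_map_toMultiset {S : List (ℕ × ℕ)} {f : MI 6 → ℕ} {x n : ℕ}
    (h : ∀ K : MI 6, valS 6 S K.1 (x, n) = if f K = x then 1 else 0) (m : MI 6 →₀ ℕ) :
    (m.toMultiset.map f).count x = MSdot 6 S m (x, n) := by
  induction m using Finsupp.induction_linear with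
  | zero => simp [MSdot]
  | add m m' hm hm' => rw [map_add, Multiset.map_add, Multiset.count_add, hm, hm', MSdot_add,
      Finsupp.add_apply]
  | single K c =>
    rw [MSdot, Finsupp.sum_single_index (by simp), Finsupp.smul_apply, h,
      Finsupp.toMultiset_single, Multiset.map_nsmul, Multiset.map_singleton, Multiset.count_nsmul,
      Multiset.count_singleton]
    simp [eq_comm]

theorem initialRelIdeal_le_InIdeal (S : List (ℕ × ℕ)) : initialRelIdeal S ≤ InIdeal 6 S := by
  refine Ideal.span_mono ?_
  rintro _ ⟨I, J, hI, hJ, h0, rfl⟩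
  exact ⟨_, Ideal.subset_span ⟨I, J, hI, hJ, rfl⟩, h0, rfl⟩

namespace IterData

variable {S : List (ℕ × ℕ)} {i j : ℕ → ℕ} {L : List (ℕ × ℕ)} (hS : IterData S i j L)
include hS

theorem getD_ne_zero {k : ℕ} (hk : k < S.length) : S.getD k (0, 0) ≠ (0, 0) := by
  intro h
  rw [List.getD_eq_getElem _ _ hk] at h
  have hmem : (0, 0) ∈ S := h ▸ List.getElem_mem hk
  rw [hS.eq] at hmem
  simp [hS.mem_base] at hmem

theorem InIdeal_eq : InIdeal 6 S = initialRelIdeal S := by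
  obtain ⟨r, q, p, hV⟩ := hS.exists_valData
  obtain ⟨hval, s, hs⟩ := hS.exists_isLead_valS hV
  have hv0 : ∀ K : MI 6, valS 6 S K.1 (0, 0) = 0 := fun K => by rw [hval, wt_apply_zero]
  have hker := InIdeal_le_ker (fun k => hS.getD_ne_zero) hv0 hs
  refine le_antisymm (hker.trans (ker_leadMap_le (fun K => (hs K).1)
    ((initialRelIdeal_le_InIdeal S).trans hker) fun m m' h => ?_)) (initialRelIdeal_le_InIdeal S)
  have hM := MSdot_eq_of_leadExp_eq hv0 h
  have hcard : m.toMultiset.card = m'.toMultiset.card := by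
    rw [leadExp_eq, leadExp_eq, hM] at h
    rw [Finsupp.card_toMultiset, Finsupp.card_toMultiset]
    exact Finsupp.single_injective _ (add_right_cancel h)
  have hmap : ∀ (f : MI 6 → ℕ) (n : ℕ), (∀ (x : ℕ) (K : MI 6), x ≠ n →
      valS 6 S K.1 (x, n) = if f K = x then 1 else 0) →
      m.toMultiset.map f = m'.toMultiset.map f := by
    intro f n hf
    refine multiset_eq_of_count_eq n (by simpa using hcard) fun x hx => ?_
    rw [count_map_toMultiset fun K => hf x K hx, count_map_toMultiset fun K => hf x K hx, hM]
  exact hS.binomialIn_of_map_eq hV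
    (hmap r 6 fun x K hx => by rw [hval, wt_apply_six hx])
    (hmap q 5 fun x K hx => by rw [hval, wt_apply_five hx])
    (hmap p 4 fun x K hx => by rw [hval, wt_apply_four hx])

end IterData

/-- For every iterated sequence `S` for `Gr(3,6)`, the nonzero Plücker relations form a
Gröbner basis for `𝓘_{3,6}` with respect to `M_S`. -/
theorem plucker_relations_groebner (S : List (ℕ × ℕ)) (hS : IsIter 6 S) :
    InIdeal 6 S = Ideal.span {g | ∃ I J, Sorted 2 6 I ∧ Sorted 4 6 J ∧ Rrel 6 I J ≠ 0 ∧
      g = inM 6 S (Rrel 6 I J)} := by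
  obtain ⟨i, j, L, h⟩ := hS.exists_iterData
  exact h.InIdeal_eq
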